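/- For every integer n with n ≡ 4 (mod 8) and n ≥ 324 there exists a cyclically 6-connected strictly critical snark of order n. -/

import Mathlib

/-- The colour set `K = (ℤ₂ × ℤ₂) ∖ {(0,0)}`. -/
abbrev Kol : Type := {x : ZMod 2 × ZMod 2 // x ≠ 0}

/-- A proper edge colouring: distinct edges sharing a vertex get distinct colours. -/
def IsProperEdgeColoring {V C : Type*} (G : SimpleGraph V) (f : Sym2 V → C) : Prop :=
  ∀ e₁ ∈ G.edgeSet, ∀ e₂ ∈ G.edgeSet, e₁ ≠ e₂ → (∃ v : V, v ∈ e₁ ∧ v ∈ e₂) → f e₁ ≠ f e₂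

/-- A graph is 3-edge-colourable if it has a proper edge colouring with three colours. -/
def ThreeEdgeColorable {V : Type*} (G : SimpleGraph V) : Prop :=
  ∃ f : Sym2 V → Kol, IsProperEdgeColoring G f

/-- A graph is cubic if every vertex has degree 3. -/
def IsCubic {V : Type*} (G : SimpleGraph V) : Prop :=
  ∀ v : V, (G.neighborSet v).ncard = 3

/-- A snark: a connected cubic simple graph which is not 3-edge-colourable. -/
def IsSnark {V : Type*} (G : SimpleGraph V) : Prop :=
  G.Connected ∧ IsCubic G ∧ ¬ ThreeEdgeColorable G

/-- A snark is critical if removing any two distinct adjacent vertices yields a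
3-edge-colourable graph. -/
def Critical {V : Type*} (G : SimpleGraph V) : Prop :=
  ∀ u v : V, G.Adj u v → ThreeEdgeColorable (G.induce ({u, v}ᶜ : Set V))

/-- A snark is bicritical if removing any two distinct vertices yields a
3-edge-colourable graph. -/
def Bicritical {V : Type*} (G : SimpleGraph V) : Prop :=
  ∀ u v : V, u ≠ v → ThreeEdgeColorable (G.induce ({u, v}ᶜ : Set V))

/-- Strictly critical: critical but not bicritical. -/
def StrictlyCritical {V : Type*} (G : SimpleGraph V) : Prop :=
  Critical G ∧ ¬ Bicritical G

/-- A cubic graph is cyclically `k`-connected if no set of fewer than `k` edges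
separates two cycles, i.e. there is no set `F` of fewer than `k` edges whose deletion
leaves a graph in which two connected components contain a cycle. -/
def CyclicallyConnected {V : Type*} (G : SimpleGraph V) (k : ℕ) : Prop :=
  ¬ ∃ F : Set (Sym2 V), F ⊆ G.edgeSet ∧ F.ncard < k ∧
    ∃ a b : V, (∃ w : (G.deleteEdges F).Walk a a, w.IsCycle) ∧
               (∃ w : (G.deleteEdges F).Walk b b, w.IsCycle) ∧
               ¬ (G.deleteEdges F).Reachable a b

/-- The cyclic connectivity of a cubic graph: the largest `k` (at most the number of
edges) such that the graph is cyclically `k`-connected. -/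
noncomputable def cyclicConnectivity {V : Type*} (G : SimpleGraph V) : ℕ :=
  sSup {k | k ≤ G.edgeSet.ncard ∧ CyclicallyConnected G k}

/-- The Klein four-group, whose nonzero elements are the three colours. -/
abbrev V4 : Type := ZMod 2 × ZMod 2

/-- A presentation of a simple cubic graph by darts: `rev` reverses a dart, `vtx` is the initial
vertex, and `dart v` lists the three darts leaving `v`. -/
structure CubicPresentation (V D : Type*) where
  vtx : D → V
  dart : V → Fin 3 → D
  rev : D → D
  vtx_dart : ∀ v p, vtx (dart v p) = v
  exists_dart : ∀ d, ∃ p, dart (vtx d) p = d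
  dart_injective : ∀ v, Function.Injective (dart v)
  rev_rev : ∀ d, rev (rev d) = d
  vtx_rev_ne : ∀ d, vtx (rev d) ≠ vtx d
  simple : ∀ d d', vtx d = vtx d' → vtx (rev d) = vtx (rev d') → d = d'

namespace CubicPresentation

variable {V W D : Type*} (P : CubicPresentation V D)

/-- Relabelling the vertices along an equivalence. -/
def relabel (φ : V ≃ W) : CubicPresentation W D where
  vtx d := φ (P.vtx d)
  dart w := P.dart (φ.symm w)
  rev := P.rev
  vtx_dart v p := by simp [P.vtx_dart]
  exists_dart d := by simpa using P.exists_dart d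
  dart_injective v := P.dart_injective _
  rev_rev := P.rev_rev
  vtx_rev_ne d h := P.vtx_rev_ne d (φ.injective h)
  simple d d' h h' := P.simple d d' (φ.injective h) (φ.injective h')

/-- The graph presented by `P`. -/
def graph : SimpleGraph V where
  Adj a b := ∃ d, P.vtx d = a ∧ P.vtx (P.rev d) = b
  symm := ⟨by
    rintro a b ⟨d, rfl, rfl⟩
    exact ⟨P.rev d, rfl, by rw [P.rev_rev]⟩⟩
  loopless := ⟨by
    rintro a ⟨d, h, h'⟩
    exact P.vtx_rev_ne d (h'.trans h.symm)⟩

/-- The `p`-th neighbour of `v`. -/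
def nbr (v : V) (p : Fin 3) : V := P.vtx (P.rev (P.dart v p))

lemma nbr_injective (v : V) : Function.Injective (P.nbr v) := fun p q h =>
  P.dart_injective v (P.simple _ _ (by simp [P.vtx_dart]) h)

lemma adj_iff {a b : V} : P.graph.Adj a b ↔ ∃ p, P.nbr a p = b := by
  constructor
  · rintro ⟨d, rfl, rfl⟩
    obtain ⟨p, hp⟩ := P.exists_dart d
    exact ⟨p, by rw [nbr, hp]⟩
  · rintro ⟨p, rfl⟩
    exact ⟨_, P.vtx_dart _ _, rfl⟩

lemma isCubic : IsCubic P.graph := by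
  intro v
  have : P.graph.neighborSet v = Set.range (P.nbr v) := by
    ext w
    simp [P.adj_iff]
  rw [this, ← Set.image_univ, Set.ncard_image_of_injective _ (P.nbr_injective v)]
  simp

lemma eq_or_eq_rev {d d' : D} (h : s(P.vtx d, P.vtx (P.rev d)) = s(P.vtx d', P.vtx (P.rev d'))) :
    d = d' ∨ d = P.rev d' := by
  rcases Sym2.eq_iff.1 h with ⟨h1, h2⟩ | ⟨h1, h2⟩
  · exact .inl (P.simple _ _ h1 h2)
  · exact .inr (P.simple _ _ h1 (by rw [h2, P.rev_rev]))

/-- A symmetric function on darts summing to zero around every vertex. -/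
structure IsFlow (c : D → V4) : Prop where
  rev : ∀ d, c (P.rev d) = c d
  sum : ∀ v, ∑ p, c (P.dart v p) = 0

lemma V4.ne_of_sum_eq_zero (x : Fin 3 → V4) (h : ∑ p, x p = 0) (h0 : ∀ p, x p ≠ 0) {p q : Fin 3}
    (hpq : p ≠ q) : x p ≠ x q := by
  have key : ∀ a b c : V4, a + b + c = 0 → a ≠ 0 → b ≠ 0 → c ≠ 0 → a ≠ b ∧ a ≠ c ∧ b ≠ c := by
    decide
  obtain ⟨h1, h2, h3⟩ := key (x 0) (x 1) (x 2) (by rw [← h, Fin.sum_univ_three])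
    (h0 0) (h0 1) (h0 2)
  fin_cases p <;> fin_cases q <;>
    first | exact absurd rfl hpq | assumption | (apply Ne.symm; assumption)

lemma V4.sum_eq_zero_of_injective (x : Fin 3 → V4) (hx : Function.Injective x)
    (h0 : ∀ p, x p ≠ 0) : ∑ p, x p = 0 := by
  have key : ∀ a b c : V4, a ≠ 0 → b ≠ 0 → c ≠ 0 → a ≠ b → a ≠ c → b ≠ c → a + b + c = 0 := by
    decide
  rw [Fin.sum_univ_three]
  exact key _ _ _ (h0 0) (h0 1) (h0 2) (hx.ne (by decide)) (hx.ne (by decide)) (hx.ne (by decide))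

/-- A flow vanishing on a single edge yields a colouring of the graph without the ends of the
edge. -/
lemma colorable_of_flow {c : D → V4} (hc : P.IsFlow c) {d₀ : D}
    (h0 : ∀ d, c d = 0 → d = d₀ ∨ d = P.rev d₀) :
    ThreeEdgeColorable
      (P.graph.induce ({P.vtx d₀, P.vtx (P.rev d₀)}ᶜ : Set V)) := by
  classical
  set X : Set V := {P.vtx d₀, P.vtx (P.rev d₀)}ᶜ with hX
  have hne : ∀ d, P.vtx d ∈ X → c d ≠ 0 := by
    intro d hd hcd
    rcases h0 d hcd with rfl | rfl <;> simp [hX] at hd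
  let f : Sym2 X → Kol := fun z =>
    if h : ∃ d, z.map Subtype.val = s(P.vtx d, P.vtx (P.rev d)) ∧ c d ≠ 0 then
      ⟨c h.choose, h.choose_spec.2⟩ else ⟨(1, 0), by decide⟩
  have hf : ∀ (x y : X) (d : D), P.vtx d = x → P.vtx (P.rev d) = y → (f s(x, y)).1 = c d := by
    intro x y d hx hy
    have hex : ∃ d, s(x, y).map Subtype.val = s(P.vtx d, P.vtx (P.rev d)) ∧ c d ≠ 0 :=
      ⟨d, by simp [hx, hy], hne d (hx ▸ x.2)⟩
    have : f s(x, y) = ⟨c hex.choose, hex.choose_spec.2⟩ := dif_pos hex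
    rw [this]
    have h1 : s(P.vtx d, P.vtx (P.rev d)) = _ := (by simp [hx, hy] :
      _ = s(x, y).map Subtype.val).trans hex.choose_spec.1
    rcases P.eq_or_eq_rev h1 with h | h
    · exact congrArg c h.symm
    · rw [h, hc.rev]
  refine ⟨f, ?_⟩
  rintro e₁ he₁ e₂ he₂ hne12 ⟨w, hw1, hw2⟩
  obtain ⟨y₁, rfl⟩ := hw1
  obtain ⟨y₂, rfl⟩ := hw2
  obtain ⟨p, hp⟩ := P.adj_iff.1 (show P.graph.Adj w y₁ from he₁)
  obtain ⟨q, hq⟩ := P.adj_iff.1 (show P.graph.Adj w y₂ from he₂)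
  have hpq : p ≠ q := by
    rintro rfl
    exact hne12 (by rw [Subtype.ext (hp.symm.trans hq)])
  intro heq
  have h1 := hf w y₁ _ (P.vtx_dart w p) hp
  have h2 := hf w y₂ _ (P.vtx_dart w q) hq
  rw [heq, h2] at h1
  exact V4.ne_of_sum_eq_zero (fun p => c (P.dart w p)) (hc.sum w)
    (fun p => hne _ (by rw [P.vtx_dart]; exact w.2)) hpq h1.symm

/-- A colouring of the graph without two vertices at distance at least three extends to the
dangling edges. -/
lemma exists_coloring_of_colorable {a b : V} (hab : ∀ p, P.nbr a p ≠ b)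
    (hab' : ∀ p q, P.nbr a p ≠ P.nbr b q)
    (h : ThreeEdgeColorable (P.graph.induce ({a, b}ᶜ : Set V))) :
    ∃ c : D → V4, (∀ d, c d ≠ 0) ∧ (∀ d, c (P.rev d) = c d) ∧
      ∀ v, v ≠ a → v ≠ b → ∑ p, c (P.dart v p) = 0 := by
  classical
  set X : Set V := {a, b}ᶜ with hX
  obtain ⟨f, hf⟩ := h
  let g : D → V4 := fun d =>
    if h : P.vtx d ∈ X ∧ P.vtx (P.rev d) ∈ X then (f s(⟨_, h.1⟩, ⟨_, h.2⟩)).1 else 0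
  have g_rev : ∀ d, g (P.rev d) = g d := by
    intro d
    by_cases h : P.vtx d ∈ X ∧ P.vtx (P.rev d) ∈ X
    · have h' : P.vtx (P.rev d) ∈ X ∧ P.vtx (P.rev (P.rev d)) ∈ X := by rwa [P.rev_rev, and_comm]
      simp only [g, dif_pos h, dif_pos h']
      rw [Sym2.eq_swap]
      simp only [P.rev_rev]
    · have h' : ¬ (P.vtx (P.rev d) ∈ X ∧ P.vtx (P.rev (P.rev d)) ∈ X) := by
        rwa [P.rev_rev, and_comm]
      simp only [g, dif_neg h, dif_neg h']
  have g_ne : ∀ d, P.vtx d ∈ X → P.vtx (P.rev d) ∈ X → g d ≠ 0 := by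
    intro d h1 h2
    simp only [g, dif_pos (And.intro h1 h2)]
    exact (f _).2
  have g_zero : ∀ d, P.vtx (P.rev d) ∉ X → g d = 0 := fun d h => dif_neg (fun h' => h h'.2)
  have g_inj : ∀ v ∈ X, ∀ p q, P.nbr v p ∈ X → P.nbr v q ∈ X → p ≠ q →
      g (P.dart v p) ≠ g (P.dart v q) := by
    intro v hv p q hp hq hpq
    have hvp : P.vtx (P.dart v p) ∈ X ∧ P.vtx (P.rev (P.dart v p)) ∈ X :=
      ⟨by rwa [P.vtx_dart], hp⟩
    have hvq : P.vtx (P.dart v q) ∈ X ∧ P.vtx (P.rev (P.dart v q)) ∈ X :=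
      ⟨by rwa [P.vtx_dart], hq⟩
    simp only [g, dif_pos hvp, dif_pos hvq, P.vtx_dart]
    intro h
    refine hf s(⟨v, hv⟩, ⟨_, hp⟩) (P.adj_iff.2 ⟨p, rfl⟩) s(⟨v, hv⟩, ⟨_, hq⟩)
      (P.adj_iff.2 ⟨q, rfl⟩) ?_ ⟨⟨v, hv⟩, by simp, by simp⟩ (Subtype.ext h)
    intro h'
    rw [Sym2.congr_right] at h'
    exact hpq (P.nbr_injective v (congrArg Subtype.val h'))
  have unique_out : ∀ v p q, P.nbr v p ∉ X → P.nbr v q ∉ X → p = q := by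
    intro v p q hp hq
    have back : ∀ v p, ∃ r, P.nbr (P.nbr v p) r = v := fun v p => by
      have := (P.adj_iff (a := v)).2 ⟨p, rfl⟩
      exact P.adj_iff.1 this.symm
    simp only [hX, Set.mem_compl_iff, Set.mem_insert_iff, Set.mem_singleton_iff, not_not] at hp hq
    obtain ⟨r, hr⟩ := back v p
    obtain ⟨t, ht⟩ := back v q
    rcases hp with hp | hp <;> rcases hq with hq | hq <;> rw [hp] at hr <;> rw [hq] at ht
    · exact P.nbr_injective v (hp.trans hq.symm)
    · exact absurd (hr.trans ht.symm) (hab' _ _)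
    · exact absurd (ht.trans hr.symm) (hab' _ _)
    · exact P.nbr_injective v (hp.trans hq.symm)
  let s : V → V4 := fun v => ∑ p, g (P.dart v p)
  have s_ne : ∀ v ∈ X, ∀ p, P.nbr v p ∉ X → s v ≠ 0 := by
    intro v hv p hp
    have key : ∀ a b : V4, a ≠ b → a + b ≠ 0 := by decide
    have h0 : g (P.dart v p) = 0 := g_zero _ hp
    have hin : ∀ q, q ≠ p → P.nbr v q ∈ X := fun q hq => by
      by_contra h
      exact hq (unique_out v q p h hp)
    have hs : s v = g (P.dart v 0) + g (P.dart v 1) + g (P.dart v 2) := Fin.sum_univ_three _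
    rw [hs]
    obtain rfl | rfl | rfl : p = 0 ∨ p = 1 ∨ p = 2 := by lia
    · rw [h0, zero_add]
      exact key _ _ (g_inj v hv _ _ (hin _ (by decide)) (hin _ (by decide)) (by decide))
    · rw [h0, add_zero]
      exact key _ _ (g_inj v hv _ _ (hin _ (by decide)) (hin _ (by decide)) (by decide))
    · rw [h0, add_zero]
      exact key _ _ (g_inj v hv _ _ (hin _ (by decide)) (hin _ (by decide)) (by decide))
  have inX : ∀ d, P.vtx d ∉ X → P.vtx (P.rev d) ∈ X := by
    intro d h1
    by_contra h2
    obtain ⟨p, hp⟩ := P.exists_dart d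
    simp only [hX, Set.mem_compl_iff, Set.mem_insert_iff, Set.mem_singleton_iff, not_not] at h1 h2
    obtain ⟨q, hq⟩ := P.exists_dart (P.rev d)
    rcases h1 with h1 | h1 <;> rcases h2 with h2 | h2
    · exact P.vtx_rev_ne d (h2.trans h1.symm)
    · exact hab p (by rw [nbr, ← h1, hp, h2])
    · exact hab q (by rw [nbr, ← h2, hq, P.rev_rev, h1])
    · exact P.vtx_rev_ne d (h2.trans h1.symm)
  let c : D → V4 := fun d =>
    if P.vtx d ∉ X then s (P.vtx (P.rev d)) else if P.vtx (P.rev d) ∉ X then s (P.vtx d) else g d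
  refine ⟨c, fun d => ?_, fun d => ?_, fun v hva hvb => ?_⟩
  · by_cases h1 : P.vtx d ∈ X
    · by_cases h2 : P.vtx (P.rev d) ∈ X
      · simpa [c, h1, h2] using g_ne d h1 h2
      · obtain ⟨p, hp⟩ := P.exists_dart d
        simpa [c, h1, h2] using s_ne _ h1 p (by rwa [nbr, hp])
    · obtain ⟨p, hp⟩ := P.exists_dart (P.rev d)
      simpa [c, h1] using s_ne _ (inX d h1) p (by rwa [nbr, hp, P.rev_rev])
  · simp only [c, P.rev_rev, g_rev]
    by_cases h1 : P.vtx d ∈ X <;> by_cases h2 : P.vtx (P.rev d) ∈ X <;> simp [h1, h2]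
    exact absurd (inX d h1) h2
  · have hv : v ∈ X := by simp [hX, hva, hvb]
    have hcv : ∀ p, c (P.dart v p) = if P.nbr v p ∉ X then s v else g (P.dart v p) := by
      intro p
      by_cases h : P.vtx (P.rev (P.dart v p)) ∈ X <;> simp [c, P.vtx_dart, hv, nbr, h]
    by_cases hall : ∀ p, P.nbr v p ∈ X
    · simp only [hcv, hall, not_true, if_false]
      exact V4.sum_eq_zero_of_injective _
        (fun p q h => by_contra fun hpq => g_inj v hv p q (hall p) (hall q) hpq h)
        fun p => g_ne _ (by rwa [P.vtx_dart]) (hall p)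
    · push Not at hall
      obtain ⟨p, hp⟩ := hall
      have h1 : ∀ q, c (P.dart v q) = g (P.dart v q) + if q = p then s v else 0 := by
        intro q
        rw [hcv]
        by_cases hq : q = p
        · subst hq
          simp [hp, g_zero (P.dart v q) hp]
        · have : P.nbr v q ∈ X := by
            by_contra h
            exact hq (unique_out v q p h hp)
          simp [this, hq]
      simp only [h1, Finset.sum_add_distrib, Finset.sum_ite_eq', Finset.mem_univ, if_true]
      exact CharTwo.add_self_eq_zero (s v)

/-- The darts whose ends carry different labels. -/
def mixed [Fintype D] (ℓ : V → Bool) : Finset D :=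
  Finset.univ.filter fun d => ℓ (P.vtx (P.rev d)) ≠ ℓ (P.vtx d)

/-- A labelling in which every vertex has at most one neighbour with the other label. -/
def IsMatchingCut (ℓ : V → Bool) : Prop :=
  ∀ v p q, ℓ (P.nbr v p) ≠ ℓ v → ℓ (P.nbr v q) ≠ ℓ v → p = q

lemma mem_mixed [Fintype D] {ℓ : V → Bool} {d : D} :
    d ∈ P.mixed ℓ ↔ ℓ (P.vtx (P.rev d)) ≠ ℓ (P.vtx d) := by
  simp [mixed]

/-- Flipping the label of a vertex with two differently labelled neighbours decreases the number of
mixed darts. -/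
lemma card_mixed_update_lt [Fintype D] [DecidableEq V] {ℓ : V → Bool} {v : V} {p q : Fin 3}
    (hpq : p ≠ q) (hp : ℓ (P.nbr v p) ≠ ℓ v) (hq : ℓ (P.nbr v q) ≠ ℓ v) :
    (P.mixed (Function.update ℓ v (!ℓ v))).card < (P.mixed ℓ).card := by
  classical
  obtain ⟨r, hrp, hrq⟩ : ∃ r, r ≠ p ∧ r ≠ q := by
    have : ∀ p q : Fin 3, ∃ r, r ≠ p ∧ r ≠ q := by decide
    exact this p q
  have hall : ∀ x : Fin 3, x = p ∨ x = q ∨ x = r := by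
    have : ∀ p q r : Fin 3, p ≠ q → r ≠ p → r ≠ q → ∀ x : Fin 3, x = p ∨ x = q ∨ x = r := by decide
    exact this p q r hpq hrp hrq
  let dp := P.dart v p
  let dq := P.dart v q
  let dr := P.dart v r
  have hv : ∀ x, P.vtx (P.dart v x) = v := P.vtx_dart v
  have hne : ∀ x y, P.dart v x ≠ P.rev (P.dart v y) := fun x y h =>
    P.vtx_rev_ne (P.dart v y) (by rw [← h, hv, hv])
  have hinj : ∀ {x y}, P.dart v x = P.dart v y → x = y := fun h => P.dart_injective v h
  have hrinj : ∀ {x y}, P.rev (P.dart v x) = P.rev (P.dart v y) → x = y := fun h =>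
    P.dart_injective v (by rw [← P.rev_rev (P.dart v _), h, P.rev_rev])
  have hrem : ({dp, dq, P.rev dp, P.rev dq} : Finset D) ⊆ P.mixed ℓ := by
    intro d hd
    simp only [Finset.mem_insert, Finset.mem_singleton] at hd
    rw [mem_mixed]
    rcases hd with rfl | rfl | rfl | rfl
    · simpa only [dp, hv, nbr] using hp
    · simpa only [dq, hv, nbr] using hq
    · simpa only [dp, P.rev_rev, hv, nbr] using hp.symm
    · simpa only [dq, P.rev_rev, hv, nbr] using hq.symm
  have hcard : ({dp, dq, P.rev dp, P.rev dq} : Finset D).card = 4 := by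
    rw [Finset.card_insert_of_notMem, Finset.card_insert_of_notMem, Finset.card_insert_of_notMem,
      Finset.card_singleton]
    · simpa using fun h => hpq (hrinj h)
    · simpa [dq, dp] using ⟨hne q p, hne q q⟩
    · simpa [dq, dp] using ⟨fun h => hpq (hinj h), hne p p, hne p q⟩
  have hbool : ∀ x y : Bool, x ≠ y → x = !y := by decide
  have hsub : P.mixed (Function.update ℓ v (!ℓ v)) ⊆
      (P.mixed ℓ \ {dp, dq, P.rev dp, P.rev dq}) ∪ {dr, P.rev dr} := by
    intro d hd
    rw [mem_mixed] at hd
    simp only [Finset.mem_union, Finset.mem_sdiff, Finset.mem_insert, Finset.mem_singleton]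
    by_cases h1 : P.vtx d = v
    · obtain ⟨x, rfl⟩ : ∃ x, P.dart v x = d := h1 ▸ P.exists_dart d
      have h2 : P.vtx (P.rev (P.dart v x)) ≠ v := fun h => P.vtx_rev_ne _ (h.trans h1.symm)
      rw [h1, Function.update_self, Function.update_of_ne h2] at hd
      rcases hall x with rfl | rfl | rfl
      · exact absurd (hbool _ _ hp) hd
      · exact absurd (hbool _ _ hq) hd
      · exact .inr (.inl rfl)
    by_cases h2 : P.vtx (P.rev d) = v
    · obtain ⟨x, hx⟩ : ∃ x, P.dart v x = P.rev d := h2 ▸ P.exists_dart (P.rev d)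
      obtain rfl : d = P.rev (P.dart v x) := by rw [hx, P.rev_rev]
      rw [h2, Function.update_self, Function.update_of_ne h1] at hd
      rcases hall x with rfl | rfl | rfl
      · exact absurd (hbool _ _ hp).symm hd
      · exact absurd (hbool _ _ hq).symm hd
      · exact .inr (.inr rfl)
    rw [Function.update_of_ne h1, Function.update_of_ne h2] at hd
    refine .inl ⟨P.mem_mixed.2 hd, ?_⟩
    rintro (rfl | rfl | rfl | rfl)
    · exact h1 (hv _)
    · exact h1 (hv _)
    · exact h2 (by rw [P.rev_rev]; exact hv _)
    · exact h2 (by rw [P.rev_rev]; exact hv _)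
  have h1 := Finset.card_le_card hsub
  have h2 := Finset.card_union_le (P.mixed ℓ \ {dp, dq, P.rev dp, P.rev dq}) {dr, P.rev dr}
  have h3 := Finset.card_sdiff_add_card_eq_card hrem
  have h4 : ({dr, P.rev dr} : Finset D).card ≤ 2 := Finset.card_le_two
  lia

/-- The vertices of a cycle have two neighbours on the cycle. -/
lemma exists_two_nbr_of_isCycle {H : SimpleGraph V} (hH : H ≤ P.graph) {a : V} {w : H.Walk a a}
    (hw : w.IsCycle) {v : V} (hv : v ∈ w.support) :
    ∃ p q, p ≠ q ∧ P.nbr v p ∈ w.support ∧ P.nbr v q ∈ w.support := by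
  have h2 := hw.ncard_neighborSet_toSubgraph_eq_two hv
  obtain ⟨x, y, hxy, hs⟩ := Set.ncard_eq_two.1 h2
  have hx : w.toSubgraph.Adj v x := by
    have : x ∈ w.toSubgraph.neighborSet v := by rw [hs]; simp
    exact this
  have hy : w.toSubgraph.Adj v y := by
    have : y ∈ w.toSubgraph.neighborSet v := by rw [hs]; simp
    exact this
  obtain ⟨p, hp⟩ := P.adj_iff.1 (hH hx.adj_sub)
  obtain ⟨q, hq⟩ := P.adj_iff.1 (hH hy.adj_sub)
  refine ⟨p, q, ?_, ?_, ?_⟩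
  · rintro rfl
    exact hxy (hp.symm.trans hq)
  · rw [hp]
    exact (w.mem_verts_toSubgraph).1 hx.snd_mem
  · rw [hq]
    exact (w.mem_verts_toSubgraph).1 hy.snd_mem

/-- A cubic graph is connected if it has no empty nontrivial cut. -/
lemma connected_of_cut [Fintype D] [Nonempty V]
    (h : ∀ ℓ : V → Bool, P.mixed ℓ = ∅ → ∀ a b, ℓ a = ℓ b) : P.graph.Connected := by
  classical
  rw [SimpleGraph.connected_iff]
  refine ⟨fun a b => ?_, inferInstance⟩
  have := h (fun x => decide (P.graph.Reachable a x)) (by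
    rw [Finset.eq_empty_iff_forall_notMem]
    intro d hd
    rw [mem_mixed] at hd
    have hadj : P.graph.Adj (P.vtx d) (P.vtx (P.rev d)) := ⟨d, rfl, rfl⟩
    refine hd (decide_eq_decide.2 ⟨fun h => h.trans hadj.symm.reachable,
      fun h => h.trans hadj.reachable⟩)) a b
  simpa using this

/-- A cubic graph in which every matching cut with fewer than `k` edges is trivial is cyclically
`k`-connected. -/
lemma cyclicallyConnected_of_cut [Fintype D] [Finite V] (k : ℕ)
    (h : ∀ ℓ : V → Bool, P.IsMatchingCut ℓ → (P.mixed ℓ).card < 2 * k → ∀ a b, ℓ a = ℓ b) :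
    CyclicallyConnected P.graph k := by
  classical
  have := Fintype.ofFinite V
  rintro ⟨F, hF, hFk, a, b, ⟨wa, ha⟩, ⟨wb, hb⟩, hab⟩
  have hle := SimpleGraph.deleteEdges_le (G := P.graph) F
  let good : Finset (V → Bool) := Finset.univ.filter fun ℓ =>
    (∀ v ∈ wa.support, ℓ v = true) ∧ ∀ v ∈ wb.support, ℓ v = false
  let ℓ₀ : V → Bool := fun x => decide ((P.graph.deleteEdges F).Reachable a x)
  have hℓ₀ : ℓ₀ ∈ good := by
    simp only [good, Finset.mem_filter, Finset.mem_univ, true_and, ℓ₀, decide_eq_true_eq,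
      decide_eq_false_iff_not]
    exact ⟨fun v hv => ⟨wa.takeUntil v hv⟩,
      fun v hv hv' => hab (hv'.trans ⟨(wb.takeUntil v hv).reverse⟩)⟩
  obtain ⟨ℓ, hℓ, hmin⟩ := good.exists_min_image (fun ℓ => (P.mixed ℓ).card) ⟨ℓ₀, hℓ₀⟩
  have hcard₀ : (P.mixed ℓ₀).card < 2 * k := by
    have hmaps : ∀ d ∈ P.mixed ℓ₀, s(P.vtx d, P.vtx (P.rev d)) ∈ F.toFinite.toFinset := by
      intro d hd
      rw [Set.Finite.mem_toFinset]
      by_contra hdF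
      rw [mem_mixed] at hd
      have hadj : (P.graph.deleteEdges F).Adj (P.vtx d) (P.vtx (P.rev d)) := by
        rw [SimpleGraph.deleteEdges_adj]
        exact ⟨⟨d, rfl, rfl⟩, hdF⟩
      exact hd (decide_eq_decide.2 ⟨fun h => h.trans hadj.symm.reachable,
        fun h => h.trans hadj.reachable⟩)
    have h1 := Finset.card_le_mul_card_image_of_maps_to hmaps 2 (by
      intro z hz
      by_cases hne : ∃ d₀, s(P.vtx d₀, P.vtx (P.rev d₀)) = z
      · obtain ⟨d₀, rfl⟩ := hne
        refine (Finset.card_le_card (t := {d₀, P.rev d₀}) ?_).trans Finset.card_le_two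
        intro d hd
        simpa using P.eq_or_eq_rev (Finset.mem_filter.1 hd).2
      · rw [Finset.card_eq_zero.2]
        · lia
        · rw [Finset.eq_empty_iff_forall_notMem]
          exact fun d hd => hne ⟨d, (Finset.mem_filter.1 hd).2⟩)
    rw [← Set.ncard_eq_toFinset_card F F.toFinite] at h1
    lia
  have hℓ' := (Finset.mem_filter.1 hℓ).2
  have hno : ∀ (c : V) (w : (P.graph.deleteEdges F).Walk c c) (t : Bool), w.IsCycle →
      (∀ v ∈ w.support, ℓ v = t) → ∀ v p q, p ≠ q → ℓ (P.nbr v p) ≠ ℓ v → ℓ (P.nbr v q) ≠ ℓ v →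
      v ∉ w.support := by
    intro c w t hw ht v p q hpq hp hq hv
    obtain ⟨p', q', hpq', hp', hq'⟩ := P.exists_two_nbr_of_isCycle hle hw hv
    have e1 : ℓ (P.nbr v p') = ℓ v := (ht _ hp').trans (ht _ hv).symm
    have e2 : ℓ (P.nbr v q') = ℓ v := (ht _ hq').trans (ht _ hv).symm
    have : ∀ p q p' q' : Fin 3, p ≠ q → p' ≠ q' → p = p' ∨ p = q' ∨ q = p' ∨ q = q' := by decide
    rcases this p q p' q' hpq hpq' with rfl | rfl | rfl | rfl
    · exact hp e1
    · exact hp e2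
    · exact hq e1
    · exact hq e2
  have hmatch : P.IsMatchingCut ℓ := by
    intro v p q hp hq
    by_contra hpq
    have hva := hno a wa true ha hℓ'.1 v p q hpq hp hq
    have hvb := hno b wb false hb hℓ'.2 v p q hpq hp hq
    have hlt := P.card_mixed_update_lt hpq hp hq
    refine absurd (hmin (Function.update ℓ v (!ℓ v)) ?_) (not_le.2 hlt)
    refine Finset.mem_filter.2 ⟨Finset.mem_univ _, fun x hx => ?_, fun x hx => ?_⟩
    · rw [Function.update_of_ne (by rintro rfl; exact hva hx)]
      exact hℓ'.1 x hx
    · rw [Function.update_of_ne (by rintro rfl; exact hvb hx)]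
      exact hℓ'.2 x hx
  have := h ℓ hmatch ((hmin ℓ₀ hℓ₀).trans_lt hcard₀) a b
  rw [hℓ'.1 a wa.start_mem_support, hℓ'.2 b wb.start_mem_support] at this
  exact absurd this (by decide)

end CubicPresentation

/-- The transposition of the first two rails of a flower. -/
def twist : Fin 3 → Fin 3 := ![1, 0, 2]

/-- The transposition of the last two slots. -/
def swap12 : Fin 3 → Fin 3 := ![0, 2, 1]

@[simp] lemma twist_twist : ∀ j, twist (twist j) = j := by decide

@[simp] lemma swap12_swap12 : ∀ j, swap12 (swap12 j) = j := by decide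

/-- Vertices of the flower with `k + 5` claws: the centre `(i, none)` and the leaves `(i, some j)`
of each claw. -/
abbrev FlowerVertex (k : ℕ) : Type := Fin (k + 5) × Option (Fin 3)

/-- Darts of the flower, given by a vertex and a slot. -/
abbrev FlowerDart (k : ℕ) : Type := FlowerVertex k × Fin 3

namespace Flower

variable {k : ℕ}

/-- The cyclically next claw. -/
def next (i : Fin (k + 5)) : Fin (k + 5) := ⟨if i.1 = k + 4 then 0 else i.1 + 1, by split <;> lia⟩

/-- The cyclically previous claw. -/
def prev (i : Fin (k + 5)) : Fin (k + 5) := ⟨if i.1 = 0 then k + 4 else i.1 - 1, by split <;> lia⟩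

@[simp] lemma next_prev (i : Fin (k + 5)) : next (prev i) = i := by
  ext
  simp only [next, prev]
  split_ifs <;> lia

@[simp] lemma prev_next (i : Fin (k + 5)) : prev (next i) = i := by
  ext
  simp only [next, prev]
  split_ifs <;> lia

lemma next_ne (i : Fin (k + 5)) : next i ≠ i := by
  simp only [next, ne_eq, Fin.ext_iff]
  split_ifs <;> lia

lemma prev_ne (i : Fin (k + 5)) : prev i ≠ i := by
  simp only [prev, ne_eq, Fin.ext_iff]
  split_ifs <;> lia

lemma prev_ne_next (i : Fin (k + 5)) : prev i ≠ next i := by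
  simp only [prev, next, ne_eq, Fin.ext_iff]
  split_ifs <;> lia

/-- Reversal of darts: the centre of claw `i` is joined to its three leaves, and the leaves of
consecutive claws are joined along rails. -/
def rev : FlowerDart k → FlowerDart k
  | ((i, none), j) => ((i, some j), 0)
  | ((i, some j), 0) => ((i, none), j)
  | ((i, some j), 1) => ((prev i, some (twist j)), 2)
  | ((i, some j), 2) => ((next i, some (twist j)), 1)

lemma rev_rev (d : FlowerDart k) : rev (rev d) = d := by
  obtain ⟨⟨i, _ | j⟩, p⟩ := d
  · rfl
  · obtain rfl | rfl | rfl : p = 0 ∨ p = 1 ∨ p = 2 := by lia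
    · rfl
    · simp [rev]
    · simp [rev]

/-- The two removed vertices. -/
def cut : Bool → FlowerVertex k
  | true => (0, some 2)
  | false => (1, some 0)

lemma cut_injective : Function.Injective (cut (k := k)) := by
  intro b b' h
  cases b <;> cases b' <;> simp [cut] at h ⊢

lemma rev_vertex_ne (d : FlowerDart k) : (rev d).1 ≠ d.1 := by
  obtain ⟨⟨i, _ | j⟩, p⟩ := d
  · simp [rev]
  · obtain rfl | rfl | rfl : p = 0 ∨ p = 1 ∨ p = 2 := by lia
    · simp [rev]
    · simpa [rev] using fun h => absurd h (prev_ne i)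
    · simpa [rev] using fun h => absurd h (next_ne i)

lemma rev_cut_ne (b b' : Bool) (p : Fin 3) : (rev (k := k) (cut b, p)).1 ≠ cut b' := by
  obtain rfl | rfl | rfl : p = 0 ∨ p = 1 ∨ p = 2 := by lia
  all_goals cases b <;> cases b' <;> simp [rev, cut, next, prev, twist, Fin.ext_iff]

lemma rev_simple (w : FlowerVertex k) (p q : Fin 3) (h : (rev (w, p)).1 = (rev (w, q)).1) :
    p = q := by
  obtain ⟨i, _ | j⟩ := w
  · simpa [rev] using h
  · have := prev_ne_next i
    have := (prev_ne_next i).symm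
    obtain rfl | rfl | rfl : p = 0 ∨ p = 1 ∨ p = 2 := by lia
    all_goals
      obtain rfl | rfl | rfl : q = 0 ∨ q = 1 ∨ q = 2 := by lia
      all_goals simp_all [rev]

end Flower

namespace Petersen

/-- The two ends of an edge of the Petersen graph. -/
def ends (e : Fin 15) (b : Bool) : Fin 10 :=
  match b with
  | true => ![0, 1, 2, 3, 4, 0, 1, 2, 3, 4, 5, 6, 7, 8, 9] e
  | false => ![1, 2, 3, 4, 0, 5, 6, 7, 8, 9, 7, 8, 9, 5, 6] e

/-- The three half-edges at a vertex of the Petersen graph. -/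
def half : Fin 10 → Fin 3 → Fin 15 × Bool :=
  ![![(0, true), (4, false), (5, true)],
    ![(0, false), (1, true), (6, true)],
    ![(1, false), (2, true), (7, true)],
    ![(2, false), (3, true), (8, true)],
    ![(3, false), (4, true), (9, true)],
    ![(5, false), (10, true), (13, false)],
    ![(6, false), (11, true), (14, false)],
    ![(7, false), (10, false), (12, true)],
    ![(8, false), (11, false), (13, true)],
    ![(9, false), (12, false), (14, true)]]

lemma ends_half : ∀ x i, ends (half x i).1 (half x i).2 = x := by decide

lemma exists_half : ∀ e b, ∃ i, half (ends e b) i = (e, b) := by decide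

lemma half_injective : ∀ x i j, (half x i).1 = (half x j).1 → i = j := by decide

lemma half_bijective : Function.Bijective fun y : Fin 10 × Fin 3 => half y.1 y.2 := by decide

lemma ends_ne : ∀ e, ends e true ≠ ends e false := by decide

end Petersen

/-- The vertices of the superposition: three for each vertex of the Petersen graph, and those of a
flower with two removed vertices for each of its edges. -/
abbrev SuperVertex (k : Fin 15 → ℕ) : Type :=
  (Fin 10 × Fin 3) ⊕
    Σ e : Fin 15, {w : FlowerVertex (k e) // w ≠ Flower.cut true ∧ w ≠ Flower.cut false}

namespace Super

open Petersen

variable {k : Fin 15 → ℕ}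

/-- The slots at a removed vertex are attached to the triple in an order depending on the end. -/
def slot : Bool → Fin 3 → Fin 3
  | true => id
  | false => swap12

@[simp] lemma slot_slot (b : Bool) (p : Fin 3) : slot b (slot b p) = p := by
  cases b <;> simp [slot]

/-- The initial vertex of a dart. -/
def vtx (d : Σ e, FlowerDart (k e)) : SuperVertex k :=
  if h : d.2.1 = Flower.cut true then .inl (ends d.1 true, slot true d.2.2)
  else if h' : d.2.1 = Flower.cut false then .inl (ends d.1 false, slot false d.2.2)
  else .inr ⟨d.1, d.2.1, h, h'⟩

/-- The three darts leaving a vertex. -/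
def dart : SuperVertex k → Fin 3 → Σ e, FlowerDart (k e)
  | .inl (x, s), p => ⟨(half x p).1, Flower.cut (half x p).2, slot (half x p).2 s⟩
  | .inr ⟨e, w⟩, p => ⟨e, w.1, p⟩

lemma vtx_cut (e : Fin 15) (b : Bool) (p : Fin 3) :
    vtx (k := k) ⟨e, Flower.cut b, p⟩ = .inl (ends e b, slot b p) := by
  cases b
  · have : Flower.cut (k := k e) false ≠ Flower.cut true := fun h => by
      simpa using Flower.cut_injective h
    simp [vtx, this]
  · simp [vtx]

lemma vtx_inner {e : Fin 15} {w : FlowerVertex (k e)} (h : ∀ b, w ≠ Flower.cut b) (p : Fin 3) :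
    vtx (k := k) ⟨e, w, p⟩ = .inr ⟨e, w, h true, h false⟩ := by
  simp [vtx, h]

lemma eq_of_vtx_eq {e : Fin 15} {d d' : FlowerDart (k e)}
    (h : vtx (k := k) ⟨e, d⟩ = vtx ⟨e, d'⟩) : d.1 = d'.1 ∧ ∀ b, d.1 = Flower.cut b → d = d' := by
  obtain ⟨w, p⟩ := d
  obtain ⟨w', p'⟩ := d'
  by_cases h1 : ∃ b, w = Flower.cut b <;> by_cases h2 : ∃ b, w' = Flower.cut b
  · obtain ⟨b, rfl⟩ := h1
    obtain ⟨b', rfl⟩ := h2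
    rw [vtx_cut, vtx_cut] at h
    simp only [Sum.inl.injEq, Prod.mk.injEq] at h
    obtain rfl : b = b' := by
      have := ends_ne e
      have := (ends_ne e).symm
      cases b <;> cases b' <;> simp_all
    have : p = p' := by simpa using congrArg (slot b) h.2
    simp [this]
  · push Not at h2
    obtain ⟨b, rfl⟩ := h1
    simp [vtx_cut, vtx_inner h2] at h
  · push Not at h1
    obtain ⟨b, rfl⟩ := h2
    simp [vtx_cut, vtx_inner h1] at h
  · push Not at h1 h2
    simp only [vtx_inner h1, vtx_inner h2] at h
    exact ⟨by simpa using h, fun b hb => absurd hb (h1 b)⟩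

/-- The superposition of flowers on the edges of the Petersen graph. -/
def presentation (k : Fin 15 → ℕ) : CubicPresentation (SuperVertex k) (Σ e, FlowerDart (k e)) where
  vtx := vtx
  dart := dart
  rev d := ⟨d.1, Flower.rev d.2⟩
  vtx_dart v p := by
    obtain ⟨x, s⟩ | ⟨e, w, h, h'⟩ := v
    · simp [dart, vtx_cut, ends_half]
    · exact vtx_inner (by rintro (_ | _) <;> assumption) p
  exists_dart d := by
    obtain ⟨e, w, p⟩ := d
    by_cases h : ∃ b, w = Flower.cut b
    · obtain ⟨b, rfl⟩ := h
      obtain ⟨i, hi⟩ := exists_half e b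
      refine ⟨i, ?_⟩
      simp only [vtx_cut, dart]
      rw [hi]
      simp
    · push Not at h
      exact ⟨p, by rw [vtx_inner h]; rfl⟩
  dart_injective v p q h := by
    obtain ⟨x, s⟩ | ⟨e, w⟩ := v
    · exact half_injective x p q (congrArg Sigma.fst h)
    · simpa [dart] using h
  rev_rev d := by rw [Flower.rev_rev]
  vtx_rev_ne d h := by
    obtain ⟨e, d⟩ := d
    exact Flower.rev_vertex_ne d (eq_of_vtx_eq h).1
  simple d d' h h' := by
    obtain ⟨e, d⟩ := d
    obtain ⟨e', d'⟩ := d'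
    obtain rfl : e = e' := by
      by_cases h1 : ∃ b, d.1 = Flower.cut b
      · obtain ⟨b, hb⟩ := h1
        have h2 : ∀ b', (Flower.rev d).1 ≠ Flower.cut b' := fun b' => by
          have := Flower.rev_cut_ne (k := k e) b b' d.2
          rwa [← hb] at this
        rw [show (⟨e, Flower.rev d⟩ : Σ e, FlowerDart (k e)) =
          ⟨e, (Flower.rev d).1, (Flower.rev d).2⟩ from rfl, vtx_inner h2] at h'
        unfold vtx at h'
        split_ifs at h'
        simpa using
          congrArg (fun x : SuperVertex k => x.elim (fun _ => none) (fun x => some x.1)) h'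
      · push Not at h1
        rw [show (⟨e, d⟩ : Σ e, FlowerDart (k e)) = ⟨e, d.1, d.2⟩ from rfl, vtx_inner h1] at h
        unfold vtx at h
        split_ifs at h
        simpa using
          congrArg (fun x : SuperVertex k => x.elim (fun _ => none) (fun x => some x.1)) h
    congr 1
    have e1 := eq_of_vtx_eq h
    have e2 := eq_of_vtx_eq h'
    obtain ⟨w, p⟩ := d
    obtain ⟨w', p'⟩ := d'
    obtain rfl : w = w' := e1.1
    rw [Flower.rev_simple w p p' e2.1]

lemma card_superVertex (k : Fin 15 → ℕ) :
    Fintype.card (SuperVertex k) = 30 + ∑ e, (4 * k e + 18) := by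
  have key : ∀ n : ℕ, Fintype.card
      {w : FlowerVertex n // w ≠ Flower.cut true ∧ w ≠ Flower.cut false} = 4 * n + 18 := by
    intro n
    have h : (Finset.univ.filter fun w : FlowerVertex n =>
        w ≠ Flower.cut true ∧ w ≠ Flower.cut false) =
        (Finset.univ.erase (Flower.cut true)).erase (Flower.cut false) := by
      ext w
      simp [and_comm]
    rw [Fintype.card_subtype, h, Finset.card_erase_of_mem, Finset.card_erase_of_mem]
    · simp
      lia
    · simp
    · simp [Flower.cut_injective.eq_iff]
  simp [key]

end Super

namespace V4

/-- The cyclic orientation of the three nonzero elements. -/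
def cyc (x y : V4) : Bool :=
  x = (0, 1) ∧ y = (1, 0) ∨ x = (1, 0) ∧ y = (1, 1) ∨ x = (1, 1) ∧ y = (0, 1)

/-- An invariant of triples of colours that alternates along the claws of a coloured flower. -/
def parity (x : Fin 3 → V4) : Bool :=
  if x 0 = x 1 then cyc (x 2) (x 0) else if x 1 = x 2 then cyc (x 0) (x 1)
  else if x 0 = x 2 then cyc (x 1) (x 0) else cyc (x 0) (x 1)

lemma parity_claw (a b b' : Fin 3 → V4) (ha0 : ∀ j, a j ≠ 0) (ha : ∑ j, a j = 0)
    (hb0 : ∀ j, b j ≠ 0) (hb0' : ∀ j, b' j ≠ 0)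
    (h : ∀ j, a j + b j + b' (twist j) = 0) : parity b' = !parity b := by
  have key : ∀ x y u v w : V4, x ≠ 0 ∧ y ≠ 0 ∧ x + y ≠ 0 ∧ u ≠ 0 ∧ v ≠ 0 ∧ w ≠ 0 ∧ x + u ≠ 0 ∧
      y + v ≠ 0 ∧ x + y + w ≠ 0 → parity ![y + v, x + u, x + y + w] = !parity ![u, v, w] := by
    decide +kernel
  rw [Fin.sum_univ_three, CharTwo.add_eq_zero] at ha
  have hb := fun j => CharTwo.add_eq_zero.1 (h j)
  have e : ∀ y : Fin 3 → V4, parity y = parity ![y 0, y 1, y 2] := fun y => rfl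
  rw [e b, e b', ← show _ = b' 0 from hb 1, ← show _ = b' 1 from hb 0,
    ← show _ = b' 2 from hb 2, ← ha]
  refine key _ _ _ _ _ ⟨ha0 0, ha0 1, ha ▸ ha0 2, hb0 0, hb0 1, hb0 2, ?_, ?_, ?_⟩
  · exact hb 0 ▸ hb0' _
  · exact hb 1 ▸ hb0' _
  · exact ha ▸ hb 2 ▸ hb0' _

end V4

namespace Flower

variable {k : ℕ}

/-- Rotation of the claws. -/
def nextEquiv : Fin (k + 5) ≃ Fin (k + 5) := ⟨next, prev, prev_next, next_prev⟩

/-- Exchange of the first two rails. -/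
def twistEquiv : Fin 3 ≃ Fin 3 := ⟨twist, twist, twist_twist, twist_twist⟩

/-- The sum of the values leaving a vertex of a flower. -/
def flux (c : FlowerDart k → V4) (w : FlowerVertex k) : V4 := ∑ p, c (w, p)

lemma flux_leaf {c : FlowerDart k → V4} (hrev : ∀ d, c (rev d) = c d) (i : Fin (k + 5))
    (j : Fin 3) : flux c (i, some j) =
      c ((i, none), j) + c ((i, some j), 1) + c ((next i, some (twist j)), 1) := by
  rw [flux, Fin.sum_univ_three, ← hrev ((i, some j), 0), ← hrev ((i, some j), 2)]
  rfl

/-- The fluxes of all leaves of a flower cancel. -/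
lemma sum_flux {c : FlowerDart k → V4} (hrev : ∀ d, c (rev d) = c d)
    (hc : ∀ i, flux c (i, none) = 0) : ∑ i, ∑ j, flux c (i, some j) = 0 := by
  simp only [flux_leaf hrev, Finset.sum_add_distrib]
  have h1 : ∑ i : Fin (k + 5), ∑ j, c ((i, none), j) = 0 := Finset.sum_eq_zero fun i _ => hc i
  have h2 : ∑ i : Fin (k + 5), ∑ j, c ((next i, some (twist j)), 1) =
      ∑ i : Fin (k + 5), ∑ j, c ((i, some j), 1) := by
    rw [← Equiv.sum_comp nextEquiv fun i => ∑ j, c ((i, some j), 1)]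
    exact Finset.sum_congr rfl fun i _ =>
      Equiv.sum_comp twistEquiv fun j => c ((next i, some j), 1)
  rw [h1, h2, zero_add]
  exact CharTwo.add_self_eq_zero _

lemma flux_cut_eq {c : FlowerDart k → V4} (hrev : ∀ d, c (rev d) = c d)
    (hc : ∀ w, (∀ b, w ≠ cut b) → flux c w = 0) (b : Bool) :
    flux c (cut b) = flux c (cut true) := by
  have h := sum_flux hrev fun i => hc _ (by rintro (_ | _) <;> simp [cut])
  rw [← Fintype.sum_prod_type', Finset.sum_eq_add (0, 2) (1, 0)] at h
  · cases b
    · exact (CharTwo.add_eq_zero.1 h).symm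
    · rfl
  · simp
  · rintro ⟨i, j⟩ - ⟨h1, h2⟩
    refine hc _ ?_
    rintro (_ | _) h' <;> simp [cut] at h'
    · exact h2 (by simp [h'])
    · exact h1 (by simp [h'])
  · simp
  · simp

/-- A flower with an odd number of claws is not 3-edge-colourable. -/
lemma flux_cut_ne_zero (hk : Even k) {c : FlowerDart k → V4} (hrev : ∀ d, c (rev d) = c d)
    (hc : ∀ w, (∀ b, w ≠ cut b) → flux c w = 0) (h0 : ∀ d, c d ≠ 0) : flux c (cut true) ≠ 0 := by
  intro hu
  have hall : ∀ w, flux c w = 0 := by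
    intro w
    by_cases h : ∃ b, w = cut b
    · obtain ⟨b, rfl⟩ := h
      rw [flux_cut_eq hrev hc, hu]
    · exact hc w (by simpa using h)
  have step : ∀ i : Fin (k + 5), V4.parity (fun j => c ((next i, some j), 1)) =
      !V4.parity (fun j => c ((i, some j), 1)) := fun i =>
    V4.parity_claw (fun j => c ((i, none), j)) _ _ (fun j => h0 _) (hall (i, none)) (fun j => h0 _)
      (fun j => h0 _) (fun j => by rw [← flux_leaf hrev, hall])
  have iter : ∀ i, (hi : i < k + 5) → V4.parity (fun j => c ((⟨i, hi⟩, some j), 1)) =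
      (V4.parity (fun j => c ((0, some j), 1)) ^^ decide (Odd i)) := by
    intro i
    induction i with
    | zero => intro hi; simp
    | succ i ih =>
      intro hi
      have h := step ⟨i, by lia⟩
      have hn : next (⟨i, by lia⟩ : Fin (k + 5)) = ⟨i + 1, hi⟩ := by
        ext
        simp only [next]
        rw [if_neg (by lia)]
      rw [hn, ih] at h
      rw [h]
      by_cases hodd : Odd i <;> simp [hodd, Nat.odd_add_one]
  have h := step ⟨k + 4, by lia⟩
  have hn : next (⟨k + 4, by lia⟩ : Fin (k + 5)) = 0 := by
    ext
    simp [next]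
  rw [hn] at h
  have hodd : ¬ Odd (k + 4) := by
    rw [Nat.not_odd_iff_even]
    exact hk.add (by decide)
  rw [iter (k + 4)] at h
  simp [hodd] at h

end Flower

namespace Petersen

/-- The Petersen graph is not 3-edge-colourable. -/
lemma not_colorable (s : Fin 15 → V4) (h0 : ∀ e, s e ≠ 0)
    (h : ∀ x, ∑ i, s (half x i).1 = 0) : False := by
  have key : ∀ a b c d e t : V4, 0 ∈ [a, b, c, d, e, t, a + e, a + b, b + c, c + d, d + e,
      b + c + t, d + e + (b + c + t), a + b + (d + e + (b + c + t)),
      c + d + (a + b + (d + e + (b + c + t)))] := by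
    decide +kernel
  have hx : ∀ x, s (half x 0).1 + s (half x 1).1 + s (half x 2).1 = 0 := fun x => by
    rw [← Fin.sum_univ_three fun i => s (half x i).1]
    exact h x
  have h2 : ∀ x y z : V4, x + y + z = 0 → z = x + y := by decide
  have h1 : ∀ x y z : V4, x + y + z = 0 → y = x + z := by decide
  have h5 : s 5 = s 0 + s 4 := h2 _ _ _ (hx 0)
  have h6 : s 6 = s 0 + s 1 := h2 _ _ _ (hx 1)
  have h7 : s 7 = s 1 + s 2 := h2 _ _ _ (hx 2)
  have h8 : s 8 = s 2 + s 3 := h2 _ _ _ (hx 3)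
  have h9 : s 9 = s 3 + s 4 := h2 _ _ _ (hx 4)
  have h12 : s 12 = s 7 + s 10 := h2 _ _ _ (hx 7)
  have h14 : s 14 = s 9 + s 12 := h2 _ _ _ (hx 9)
  have h11 : s 11 = s 6 + s 14 := h1 _ _ _ (hx 6)
  have h13 : s 13 = s 8 + s 11 := h2 _ _ _ (hx 8)
  have := key (s 0) (s 1) (s 2) (s 3) (s 4) (s 10)
  rw [← h5, ← h6, ← h7, ← h8, ← h9, ← h12, ← h14, ← h11, ← h13] at this
  simp only [List.mem_cons, List.not_mem_nil, (h0 _).symm, or_self] at this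

end Petersen

namespace Super

open Petersen

variable {k : Fin 15 → ℕ}

/-- The superposition has no nowhere-zero symmetric function on its darts that sums to zero around
all vertices outside one triple. -/
lemma not_colorable_off_triple (hk : ∀ e, Even (k e)) (x₀ : Fin 10)
    {c : (Σ e, FlowerDart (k e)) → V4} (h0 : ∀ d, c d ≠ 0)
    (hrev : ∀ d, c ((presentation k).rev d) = c d)
    (hsum : ∀ v, (∀ s, v ≠ .inl (x₀, s)) → ∑ p, c ((presentation k).dart v p) = 0) : False := by
  have hrev' : ∀ e (d : FlowerDart (k e)), c ⟨e, Flower.rev d⟩ = c ⟨e, d⟩ := fun e d => hrev ⟨e, d⟩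
  have hc : ∀ e (w : FlowerVertex (k e)), (∀ b, w ≠ Flower.cut b) →
      Flower.flux (fun d => c ⟨e, d⟩) w = 0 := by
    intro e w hw
    have := hsum (.inr ⟨e, w, hw true, hw false⟩) (by simp)
    exact this
  set s : Fin 15 → V4 := fun e => Flower.flux (fun d => c ⟨e, d⟩) (Flower.cut true)
  have hb : ∀ e b, ∑ i, c ⟨e, Flower.cut b, slot b i⟩ = s e := by
    intro e b
    change _ = Flower.flux (fun d => c ⟨e, d⟩) (Flower.cut true)
    rw [← Flower.flux_cut_eq (hrev' e) (hc e) b, Flower.flux]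
    exact Equiv.sum_comp ⟨slot b, slot b, slot_slot b, slot_slot b⟩ fun p => c ⟨e, Flower.cut b, p⟩
  have hx : ∀ x, x ≠ x₀ → ∑ i, s (half x i).1 = 0 := by
    intro x hx
    rw [Finset.sum_congr rfl fun i _ => (hb (half x i).1 (half x i).2).symm, Finset.sum_comm]
    exact Finset.sum_eq_zero fun j _ => hsum (.inl (x, j)) (by simp [hx])
  refine not_colorable s (fun e => Flower.flux_cut_ne_zero (hk e) (hrev' e) (hc e) fun d => h0 _) ?_
  intro x
  by_cases h : x = x₀
  · subst h
    have htot : ∑ x, ∑ i, s (half x i).1 = 0 := by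
      have : ∀ s : Fin 15 → V4, ∑ x, ∑ i, s (half x i).1 = ∑ e, (s e + s e) := by
        intro s
        rw [← Fintype.sum_prod_type' fun x i => s (half x i).1,
          half_bijective.sum_comp fun y => s y.1, Fintype.sum_prod_type]
        simp [two_mul]
      rw [this]
      exact Finset.sum_eq_zero fun e _ => CharTwo.add_self_eq_zero _
    rwa [Finset.sum_eq_single x (fun y _ hy => hx y hy) (by simp)] at htot
  · exact hx x h

end Super

lemma ThreeEdgeColorable.induce {V : Type*} {G : SimpleGraph V} (h : ThreeEdgeColorable G)
    (s : Set V) : ThreeEdgeColorable (G.induce s) := by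
  obtain ⟨f, hf⟩ := h
  refine ⟨fun z => f (z.map Subtype.val), ?_⟩
  rintro e₁ he₁ e₂ he₂ hne ⟨v, hv₁, hv₂⟩
  refine hf _ ?_ _ ?_ (fun h => hne (Sym2.map.injective Subtype.val_injective h))
    ⟨v, Sym2.mem_map.2 ⟨v, hv₁, rfl⟩, Sym2.mem_map.2 ⟨v, hv₂, rfl⟩⟩
  · induction e₁ with | _ x y => exact he₁
  · induction e₂ with | _ x y => exact he₂

namespace CubicPresentation

variable {V W D : Type*} (P : CubicPresentation V D)

lemma IsFlow.relabel {P : CubicPresentation V D} {c : D → V4} (h : P.IsFlow c) (φ : V ≃ W) :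
    (P.relabel φ).IsFlow c :=
  ⟨h.rev, fun w => h.sum (φ.symm w)⟩

/-- A cubic graph in which every edge is the zero set of a flow is critical. -/
lemma critical_of_flow
    (h : ∀ d₀, ∃ c, P.IsFlow c ∧ ∀ d, c d = 0 → d = d₀ ∨ d = P.rev d₀) : Critical P.graph := by
  rintro u v ⟨d, rfl, rfl⟩
  obtain ⟨c, hc, h0⟩ := h d
  exact P.colorable_of_flow hc h0

end CubicPresentation

namespace Super

open Petersen

variable {k : Fin 15 → ℕ}

lemma nbr_triple (x : Fin 10) (s p : Fin 3) : ∃ w h h',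
    (presentation k).nbr (.inl (x, s)) p = .inr ⟨(half x p).1, w, h, h'⟩ ∧
      w = (Flower.rev (Flower.cut (half x p).2, slot (half x p).2 s)).1 := by
  have := fun b => Flower.rev_cut_ne (k := k (half x p).1) (half x p).2 b (slot (half x p).2 s)
  exact ⟨_, this true, this false, vtx_inner this _, rfl⟩

/-- Removing two vertices of a triple leaves a graph that is not 3-edge-colourable. -/
lemma not_threeEdgeColorable_remove {W : Type*} (hk : ∀ e, Even (k e)) (φ : SuperVertex k ≃ W) :
    ¬ ThreeEdgeColorable (((presentation k).relabel φ).graph.induce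
      ({φ (.inl (0, 0)), φ (.inl (0, 1))}ᶜ : Set W)) := by
  intro h
  have hnbr : ∀ p, ((presentation k).relabel φ).nbr (φ (.inl (0, 0))) p ≠ φ (.inl (0, 1)) := by
    intro p h
    obtain ⟨w, h1, h2, h3, -⟩ := nbr_triple (k := k) 0 0 p
    have : (presentation k).nbr (.inl (0, 0)) p = .inl (0, 1) := by
      simpa [CubicPresentation.relabel, CubicPresentation.nbr] using h
    simp [h3] at this
  have hnbr' : ∀ p q, ((presentation k).relabel φ).nbr (φ (.inl (0, 0))) p ≠
      ((presentation k).relabel φ).nbr (φ (.inl (0, 1))) q := by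
    intro p q h
    obtain ⟨w, h1, h2, h3, h4⟩ := nbr_triple (k := k) 0 0 p
    obtain ⟨w', h1', h2', h3', h4'⟩ := nbr_triple (k := k) 0 1 q
    have : (presentation k).nbr (.inl (0, 0)) p = (presentation k).nbr (.inl (0, 1)) q := by
      simpa [CubicPresentation.relabel, CubicPresentation.nbr] using h
    rw [h3, h3'] at this
    obtain rfl : p = q := half_injective 0 p q (congrArg Sigma.fst (Sum.inr_injective this))
    have hw : w = w' := by simpa using this
    subst h4 h4'
    have := congrArg (slot (half 0 p).2) (Flower.rev_simple _ _ _ hw)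
    simp at this
  obtain ⟨c, h0, hrev, hsum⟩ := CubicPresentation.exists_coloring_of_colorable _ hnbr hnbr' h
  refine not_colorable_off_triple hk 0 h0 hrev fun v hv => ?_
  simpa [CubicPresentation.relabel] using hsum (φ v) (by simpa using hv 0) (by simpa using hv 1)

lemma not_threeEdgeColorable {W : Type*} (hk : ∀ e, Even (k e)) (φ : SuperVertex k ≃ W) :
    ¬ ThreeEdgeColorable ((presentation k).relabel φ).graph :=
  fun h => not_threeEdgeColorable_remove hk φ (h.induce _)

lemma not_bicritical {W : Type*} (hk : ∀ e, Even (k e)) (φ : SuperVertex k ≃ W) :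
    ¬ Bicritical ((presentation k).relabel φ).graph :=
  fun h => not_threeEdgeColorable_remove hk φ (h _ _ (by simp))

end Super

namespace Flower

/-- The prescribed sum at a leaf: `s` at the two removed vertices and zero elsewhere. -/
def excess (s : V4) (i : ℕ) (j : Fin 3) : V4 :=
  if i = 0 ∧ j = 2 ∨ i = 1 ∧ j = 0 then s else 0

/-- Values `a i j` on the spokes and `b i j` on the rails entering the leaves of a flower with `n`
claws, with sum `s` at the two removed vertices. -/
structure IsSeq (n : ℕ) (s : V4) (a b : ℕ → Fin 3 → V4) : Prop where
  periodic : b n = b 0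
  claw : ∀ i < n, ∑ j, a i j = 0
  leaf : ∀ i < n, ∀ j, a i j + b i j + b (i + 1) (twist j) = excess s i j

/-- Insertion of two claws after claw `m`, for spokes. -/
def insertSpoke (m : ℕ) (a : ℕ → Fin 3 → V4) (i : ℕ) (j : Fin 3) : V4 :=
  if i ≤ m then a i j else if i = m + 1 then a m (twist j) else a (i - 2) j

/-- Insertion of two claws after claw `m`, for rails. -/
def insertRail (m : ℕ) (b : ℕ → Fin 3 → V4) (i : ℕ) (j : Fin 3) : V4 :=
  if i ≤ m + 1 then b i j else b (i - 2) j

lemma IsSeq.insert {n m : ℕ} {s : V4} {a b : ℕ → Fin 3 → V4} (h : IsSeq n s a b) (hm : 2 ≤ m)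
    (hmn : m < n) : IsSeq (n + 2) s (insertSpoke m a) (insertRail m b) where
  periodic := by
    ext1 j
    simp only [insertRail]
    rw [if_neg (by lia), if_pos (by lia), Nat.add_sub_cancel, h.periodic]
  claw i hi := by
    simp only [insertSpoke]
    split_ifs with h1 h2
    · exact h.claw i (by lia)
    · exact (Equiv.sum_comp twistEquiv (a m)).trans (h.claw m hmn)
    · exact h.claw (i - 2) (by lia)
  leaf i hi j := by
    have hz : ∀ i j, 2 ≤ i → excess s i j = 0 := fun i j hi => if_neg (by lia)
    simp only [insertSpoke, insertRail]
    by_cases h1 : i ≤ m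
    · rw [if_pos h1, if_pos (by lia), if_pos (by lia), h.leaf i (by lia)]
    by_cases h2 : i = m + 1
    · subst h2
      have := h.leaf m hmn (twist j)
      rw [hz m _ hm, twist_twist] at this
      rw [if_neg h1, if_pos rfl, if_pos le_rfl, if_neg (by lia), hz _ _ (by lia), ← this,
        show m + 1 + 1 - 2 = m by lia]
      abel
    by_cases h3 : i = m + 2
    · subst h3
      have := h.leaf m hmn j
      rw [hz m _ hm] at this
      rw [if_neg h1, if_neg h2, if_neg (by lia), if_neg (by lia), hz _ _ (by lia), ← this]
      rfl
    · have := h.leaf (i - 2) (by lia) j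
      rw [hz _ _ (by lia)] at this
      rw [if_neg h1, if_neg h2, if_neg (by lia), if_neg (by lia), hz _ _ (by lia), ← this,
        show i + 1 - 2 = i - 2 + 1 by lia]

/-- The base four digits of a number, read as elements of the Klein four-group. -/
def digit (N i : ℕ) : V4 :=
  (if N.testBit (2 * i + 1) then 1 else 0, if N.testBit (2 * i) then 1 else 0)

/-- The spoke values encoded by a number. -/
def spoke (N i : ℕ) : Fin 3 → V4 :=
  ![digit N (2 * i + 3), digit N (2 * i + 4), digit N (2 * i + 3) + digit N (2 * i + 4)]

/-- The rail values encoded by a number. -/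
def rail (N : ℕ) (s : V4) : ℕ → Fin 3 → V4
  | 0 => ![digit N 0, digit N 1, digit N 2]
  | i + 1 => fun j => spoke N i (twist j) + rail N s i (twist j) + excess s i (twist j)

lemma isSeq_of_periodic {n N : ℕ} {s : V4} (h : rail N s n = rail N s 0) :
    IsSeq n s (spoke N) (rail N s) where
  periodic := h
  claw i _ := by
    rw [Fin.sum_univ_three]
    exact CharTwo.add_self_eq_zero _
  leaf i _ j := by
    simp only [rail, twist_twist]
    rw [← add_assoc, CharTwo.add_self_eq_zero, zero_add]

/-- Some flow on the flower with `n` claws vanishes exactly on the `j`-th rail entering claw `i`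
(if `t` holds) or on the `j`-th spoke of claw `i` (otherwise). -/
def Vanishing (n i : ℕ) (t : Bool) (j : Fin 3) : Prop :=
  ∃ a b, IsSeq n 0 a b ∧ ∀ i' < n, ∀ j',
    (a i' j' = 0 → i' = i ∧ t = false ∧ j' = j) ∧ (b i' j' = 0 → i' = i ∧ t = true ∧ j' = j)

/-- Encoded flows on the flower with five claws vanishing on a given edge. -/
def vanishingFive : List ℕ :=
  [60712741, 60709093, 39476185, 33138260, 57563537, 60745605, 60707557, 60704677, 49665957,
    49667493, 60782181, 40229785, 49754021, 49864613, 49799077, 49969061, 49913573, 60745637,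
    47341477, 59137957, 47669157, 48082853, 62287781, 61267877, 52846501, 14311333, 65381785,
    41377701, 27193253, 48716185]

/-- Encoded flows on the flower with seven claws vanishing on a given edge. -/
def vanishingSeven : List ℕ :=
  [15541626661, 15541623013, 10105805785, 8015013460, 14736316817, 15550752645, 15541621477,
    15541618597, 15542376357, 15542377893, 15541696101, 10106559385, 15542464421, 12716662693,
    15542509477, 12716767141, 12716711653, 15541659557, 12714139557, 15557091237, 12714467237,
    15542902693, 15560241061, 15559221157, 12803530661, 12764995493, 15567576997, 12741926821,
    15534546853, 15550865317, 12107276197, 15127175077, 15399804837, 12309192613, 15945654181,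
    12275048357, 13516562341, 3651559333, 16737740185, 10592346021, 6944087973, 12471346585]

/-- The position of an edge in the lists of encoded flows. -/
def edgeIndex (i : ℕ) (t : Bool) (j : Fin 3) : ℕ := 6 * i + (if t then 3 else 0) + j

/-- The number `N` encodes a flow vanishing exactly on the given edge. -/
def IsVanishingCode (n i : ℕ) (t : Bool) (j : Fin 3) (N : ℕ) : Prop :=
  (∀ j, rail N 0 n j = rail N 0 0 j) ∧ ∀ i' < n, ∀ j',
    (spoke N i' j' = 0 → i' = i ∧ t = false ∧ j' = j) ∧
      (rail N 0 i' j' = 0 → i' = i ∧ t = true ∧ j' = j)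

instance (n i : ℕ) (t : Bool) (j : Fin 3) (N : ℕ) : Decidable (IsVanishingCode n i t j N) :=
  inferInstanceAs (Decidable (_ ∧ _))

lemma vanishing_of_code {n i N : ℕ} {t : Bool} {j : Fin 3} (h : IsVanishingCode n i t j N) :
    Vanishing n i t j :=
  ⟨_, _, isSeq_of_periodic (funext h.1), h.2⟩

lemma vanishing_five : ∀ i < 5, ∀ t j, Vanishing 5 i t j := by
  have : ∀ i < 5, ∀ t j, IsVanishingCode 5 i t j (vanishingFive.getD (edgeIndex i t j) 0) := by
    decide +kernel
  exact fun i hi t j => vanishing_of_code (this i hi t j)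

lemma vanishing_seven : ∀ i < 7, ∀ t j, Vanishing 7 i t j := by
  have : ∀ i < 7, ∀ t j, IsVanishingCode 7 i t j (vanishingSeven.getD (edgeIndex i t j) 0) := by
    decide +kernel
  exact fun i hi t j => vanishing_of_code (this i hi t j)

lemma Vanishing.insert_two {n i : ℕ} {t : Bool} {j : Fin 3} (h : Vanishing n i t j) (hn : 5 ≤ n)
    (hi : i ≤ 1 ∨ 4 ≤ i) : Vanishing (n + 2) (if i ≤ 1 then i else i + 2) t j := by
  obtain ⟨a, b, hab, h0⟩ := h
  refine ⟨_, _, hab.insert (m := 2) le_rfl (by lia), fun i' hi' j' => ⟨fun h => ?_, fun h => ?_⟩⟩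
  · simp only [insertSpoke] at h
    split_ifs at h with h1 h2
    · have := (h0 i' (by lia) _).1 h
      split_ifs <;> grind
    · have := (h0 2 (by lia) _).1 h
      lia
    · have := (h0 (i' - 2) (by lia) _).1 h
      split_ifs <;> grind
  · simp only [insertRail] at h
    split_ifs at h with h1
    · have := (h0 i' (by lia) _).2 h
      split_ifs <;> grind
    · have := (h0 (i' - 2) (by lia) _).2 h
      split_ifs <;> grind

lemma Vanishing.insert_last {n i : ℕ} {t : Bool} {j : Fin 3} (h : Vanishing n i t j) (hn : 7 ≤ n)
    (hi : 2 ≤ i) (hi' : i ≤ 5) : Vanishing (n + 2) i t j := by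
  obtain ⟨a, b, hab, h0⟩ := h
  refine ⟨_, _, hab.insert (m := n - 1) (by lia) (by lia),
    fun i' hi' j' => ⟨fun h => ?_, fun h => ?_⟩⟩
  · simp only [insertSpoke] at h
    split_ifs at h with h1 h2
    · exact (h0 i' (by lia) _).1 h
    · have := (h0 (n - 1) (by lia) _).1 h
      lia
    · have := (h0 (i' - 2) (by lia) _).1 h
      lia
  · simp only [insertRail] at h
    split_ifs at h with h1
    · by_cases h2 : i' = n
      · subst h2
        rw [hab.periodic] at h
        have := (h0 0 (by lia) _).2 h
        lia
      · exact (h0 i' (by lia) _).2 h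
    · have := (h0 (i' - 2) (by lia) _).2 h
      lia

lemma vanishing_of_odd (r : ℕ) : ∀ i < 2 * r + 5, ∀ t j, Vanishing (2 * r + 5) i t j := by
  rcases r with _ | r
  · exact vanishing_five
  induction r with
  | zero => exact vanishing_seven
  | succ r ih =>
    intro i hi t j
    by_cases h1 : i ≤ 1
    · have := (ih i (by lia) t j).insert_two (by lia) (.inl h1)
      rwa [if_pos h1] at this
    by_cases h2 : i ≤ 5
    · exact (ih i (by lia) t j).insert_last (by lia) (by lia) h2
    · have := (ih (i - 2) (by lia) t j).insert_two (by lia) (.inr (by lia))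
      rw [if_neg (by lia), Nat.sub_add_cancel (by lia)] at this
      exact this

/-- The triples of values, with sum `s`, that can leave a flower at a removed vertex when the values
at the other removed vertex are constant. -/
def Admissible (s : V4) (B : Fin 3 → V4) : Prop :=
  (∀ j, B j ≠ 0) ∧ ∑ j, B j = s ∧ (B 1 = s → ∀ j, B j = s)

instance (s : V4) : DecidablePred (Admissible s) := fun _ => inferInstanceAs (Decidable (_ ∧ _))

/-- Some flow on the flower with `n` claws is nowhere zero and takes the values `B b` at the removed
vertices. -/
def Realizable (n : ℕ) (s : V4) (B : Bool → Fin 3 → V4) : Prop :=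
  ∃ a b, IsSeq n s a b ∧ (∀ i < n, ∀ j, a i j ≠ 0 ∧ b i j ≠ 0) ∧
    ![a 0 2, b 0 2, b 1 2] = B true ∧ ![a 1 0, b 2 1, b 1 0] = B false

/-- Encoded flows on the flower with five claws realizing given values. -/
def realizing : List ℕ :=
  [27752158, 62547694, 27633559, 56260350, 26896086, 49264491, 58039005, 56600190, 40230809,
    31423383, 62547438, 58038749, 39476075, 39565805, 61192701, 39475689, 56580541, 60682086,
    26898134, 31880635, 39476713, 47823479, 40230297, 56254078, 49671593, 56581565, 48606649]

lemma realizable_five : ∀ s B, s ≠ 0 → Admissible s B →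
    ∀ b, Realizable 5 s fun b' => if b = b' then B else fun _ => s := by
  have key : ∀ s x y z, s ≠ 0 → Admissible s ![x, y, z] → ∀ b, ∃ N ∈ realizing,
      (∀ j, rail N s 5 j = rail N s 0 j) ∧ (∀ i < 5, ∀ j, spoke N i j ≠ 0 ∧ rail N s i j ≠ 0) ∧
      ![spoke N 0 2, rail N s 0 2, rail N s 1 2] = (if b = true then ![x, y, z] else fun _ => s) ∧
      ![spoke N 1 0, rail N s 2 1, rail N s 1 0] =
        (if b = false then ![x, y, z] else fun _ => s) := by
    decide +kernel
  intro s B hs hB b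
  have e : B = ![B 0, B 1, B 2] := by
    ext1 j
    fin_cases j <;> rfl
  rw [e] at hB ⊢
  obtain ⟨N, -, h1, h2, h3, h4⟩ := key s _ _ _ hs hB b
  exact ⟨_, _, isSeq_of_periodic (funext h1), h2, h3, h4⟩

lemma Realizable.insert {n : ℕ} {s : V4} {B : Bool → Fin 3 → V4} (h : Realizable n s B)
    (hn : 3 ≤ n) : Realizable (n + 2) s B := by
  obtain ⟨a, b, hab, h0, hB⟩ := h
  refine ⟨_, _, hab.insert (m := 2) le_rfl (by lia), fun i hi j => ⟨?_, ?_⟩, ?_⟩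
  · simp only [insertSpoke]
    split_ifs
    · exact (h0 i (by lia) j).1
    · exact (h0 2 (by lia) _).1
    · exact (h0 (i - 2) (by lia) j).1
  · simp only [insertRail]
    split_ifs
    · by_cases h2 : i = n
      · subst h2
        rw [hab.periodic]
        exact (h0 0 (by lia) j).2
      · exact (h0 i (by lia) j).2
    · exact (h0 (i - 2) (by lia) j).2
  · simpa [insertSpoke, insertRail] using hB

lemma realizable_of_odd (r : ℕ) {s : V4} {B : Fin 3 → V4} (hs : s ≠ 0) (hB : Admissible s B)
    (b : Bool) : Realizable (2 * r + 5) s fun b' => if b = b' then B else fun _ => s := by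
  induction r with
  | zero => exact realizable_five s B hs hB b
  | succ r ih => exact ih.insert (by lia)

end Flower

namespace Flower

variable {k : ℕ}

/-- The function on darts with given spoke and rail values. -/
def ofSeq (a b : ℕ → Fin 3 → V4) : FlowerDart k → V4
  | ((i, none), j) => a i j
  | ((i, some j), 0) => a i j
  | ((i, some j), 1) => b i j
  | ((i, some j), 2) => b (i + 1) (twist j)

lemma rail_next {a b : ℕ → Fin 3 → V4} {s : V4} (h : IsSeq (k + 5) s a b) (i : Fin (k + 5)) :
    b (next i) = b (i + 1) := by
  simp only [next]
  split_ifs with hi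
  · rw [hi, ← h.periodic]
  · rfl

lemma ofSeq_rev {a b : ℕ → Fin 3 → V4} {s : V4} (h : IsSeq (k + 5) s a b) (d : FlowerDart k) :
    ofSeq a b (rev d) = ofSeq a b d := by
  have key : ∀ i j, ofSeq (k := k) a b (rev ((i, some j), 2)) = ofSeq a b ((i, some j), 2) :=
    fun i j => congrFun (rail_next h i) (twist j)
  obtain ⟨⟨i, _ | j⟩, p⟩ := d
  · rfl
  · obtain rfl | rfl | rfl : p = 0 ∨ p = 1 ∨ p = 2 := by lia
    · rfl
    · have := key (prev i) (twist j)
      rw [show ((prev i, some (twist j)), 2) = rev ((i, some j), 1) from rfl, rev_rev] at this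
      exact this.symm
    · exact key i j

lemma flux_ofSeq_center {a b : ℕ → Fin 3 → V4} {s : V4} (h : IsSeq (k + 5) s a b)
    (i : Fin (k + 5)) : flux (ofSeq a b) (i, none) = 0 :=
  h.claw i i.2

lemma flux_ofSeq_leaf {a b : ℕ → Fin 3 → V4} {s : V4} (h : IsSeq (k + 5) s a b)
    (i : Fin (k + 5)) (j : Fin 3) : flux (ofSeq a b) (i, some j) = excess s i j := by
  rw [← h.leaf i i.2, flux, Fin.sum_univ_three]
  rfl

/-- Every dart or its reversal is the dart of a spoke leaving a centre or of a rail entering a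
leaf. -/
lemma exists_canonical (d : FlowerDart k) : ∃ d', (d = d' ∨ d = rev d') ∧
    ∃ i j, d' = ((i, none), j) ∨ d' = ((i, some j), 1) := by
  obtain ⟨⟨i, _ | j⟩, p⟩ := d
  · exact ⟨_, .inl rfl, i, p, .inl rfl⟩
  · obtain rfl | rfl | rfl : p = 0 ∨ p = 1 ∨ p = 2 := by lia
    · exact ⟨((i, none), j), .inr rfl, _, _, .inl rfl⟩
    · exact ⟨_, .inl rfl, i, j, .inr rfl⟩
    · exact ⟨((next i, some (twist j)), 1), .inr (rev_rev _).symm, _, _, .inr rfl⟩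

/-- For every edge of a flower with an odd number of claws some flow vanishes only on that edge. -/
lemma exists_vanishing (hk : Even k) (d₀ : FlowerDart k) :
    ∃ c : FlowerDart k → V4, (∀ d, c (rev d) = c d) ∧ (∀ w, flux c w = 0) ∧
      ∀ d, c d = 0 → d = d₀ ∨ d = rev d₀ := by
  obtain ⟨d', hd', i, j, hij⟩ := exists_canonical d₀
  obtain ⟨t, ht⟩ : ∃ t : Bool, d' = if t then ((i, some j), 1) else ((i, none), j) := by
    rcases hij with h | h
    · exact ⟨false, by simpa using h⟩
    · exact ⟨true, by simpa using h⟩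
  obtain ⟨r, rfl⟩ := hk.two_dvd
  obtain ⟨a, b, hab, h0⟩ := vanishing_of_odd r i i.2 t j
  have hrev := ofSeq_rev (k := 2 * r) hab
  have hcan : ∀ i j d, (d = ((i, none), j) ∨ d = ((i, some j), 1)) → ofSeq (k := 2 * r) a b d = 0 →
      d = d' := by
    rintro i' j' d (rfl | rfl) hd
    · obtain ⟨h1, h2, h3⟩ := (h0 i' i'.2 j').1 hd
      simp [ht, h2, h3, Fin.ext h1]
    · obtain ⟨h1, h2, h3⟩ := (h0 i' i'.2 j').2 hd
      simp [ht, h2, h3, Fin.ext h1]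
  refine ⟨ofSeq a b, hrev, ?_, fun d hd => ?_⟩
  · rintro ⟨i, _ | j⟩
    · exact flux_ofSeq_center hab i
    · rw [flux_ofSeq_leaf hab]
      simp [excess]
  · obtain ⟨d'', hd'', i'', j'', hij''⟩ := exists_canonical d
    have : ofSeq a b d'' = 0 := by
      rcases hd'' with rfl | rfl
      · exact hd
      · rw [← hrev, hd]
    obtain rfl := hcan _ _ _ hij'' this
    rcases hd' with rfl | rfl <;> rcases hd'' with rfl | rfl <;> simp [rev_rev]

/-- Flows on a flower with prescribed values at the removed vertices. -/
lemma exists_realizing (hk : Even k) {s : V4} (hs : s ≠ 0) {B : Fin 3 → V4}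
    (hB : Admissible s B) (b : Bool) :
    ∃ c : FlowerDart k → V4, (∀ d, c (rev d) = c d) ∧ (∀ w, (∀ b, w ≠ cut b) → flux c w = 0) ∧
      (∀ d, c d ≠ 0) ∧ (∀ p, c (cut b, Super.slot b p) = B p) ∧
      ∀ p, c (cut !b, Super.slot (!b) p) = s := by
  obtain ⟨r, rfl⟩ := hk.two_dvd
  obtain ⟨a, β, hab, h0, h1, h2⟩ := realizable_of_odd r hs hB b
  have hrev := ofSeq_rev (k := 2 * r) hab
  have hval : ∀ b' p, ofSeq (k := 2 * r) a β (cut b', Super.slot b' p) =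
      (if b = b' then B else fun _ => s) p := by
    rintro (_ | _) p
    · refine Eq.trans ?_ (congrFun h2 p)
      fin_cases p <;> simp [cut, Super.slot, ofSeq, swap12, twist, Nat.mod_eq_of_lt]
    · refine Eq.trans ?_ (congrFun h1 p)
      fin_cases p <;> simp [cut, Super.slot, ofSeq, twist]
  refine ⟨ofSeq a β, hrev, ?_, fun d hd => ?_, fun p => by simp [hval], fun p => by simp [hval]⟩
  · rintro ⟨i, _ | j⟩ hw
    · exact flux_ofSeq_center hab i
    · rw [flux_ofSeq_leaf hab, excess, if_neg]
      rintro (⟨hi, rfl⟩ | ⟨hi, rfl⟩)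
      · exact hw true (by simp [cut, Fin.ext_iff, hi])
      · exact hw false (by simp [cut, Fin.ext_iff, hi])
  · obtain ⟨d', hd', i, j, hij⟩ := exists_canonical d
    have : ofSeq a β d' = 0 := by
      rcases hd' with rfl | rfl
      · exact hd
      · rw [← hrev, hd]
    rcases hij with rfl | rfl
    · exact (h0 i i.2 j).1 this
    · exact (h0 i i.2 j).2 this

/-- A zero-sum triple with at most one zero splits off admissible triples with a common sum. -/
lemma exists_admissible_split (L : Fin 3 → V4) (hL : ∑ j, L j = 0)
    (h0 : ∀ i j, L i = 0 → L j = 0 → i = j) :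
    ∃ s B, s ≠ 0 ∧ Admissible s B ∧ Admissible s (fun j => L j + B j) := by
  have key : ∀ x y : V4, ¬ (x = 0 ∧ y = 0) ∧ ¬ (x = 0 ∧ x + y = 0) ∧ ¬ (y = 0 ∧ x + y = 0) →
      ∃ c : V4 × V4 × V4 × V4, c.1 ≠ 0 ∧ Admissible c.1 ![c.2.1, c.2.2.1, c.2.2.2] ∧
        Admissible c.1 ![x + c.2.1, y + c.2.2.1, x + y + c.2.2.2] := by decide +kernel
  have e : L = ![L 0, L 1, L 0 + L 1] := by
    rw [Fin.sum_univ_three, CharTwo.add_eq_zero] at hL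
    ext1 j
    fin_cases j
    · rfl
    · rfl
    · exact hL.symm
  have h2 : L 0 + L 1 = L 2 := (congrFun e 2).symm
  obtain ⟨⟨s, u, v, w⟩, hs, h1, h2⟩ := key (L 0) (L 1)
    ⟨fun h => absurd (h0 _ _ h.1 h.2) (by decide),
      fun h => absurd (h0 0 2 h.1 (h2 ▸ h.2)) (by decide),
      fun h => absurd (h0 1 2 h.1 (h2 ▸ h.2)) (by decide)⟩
  refine ⟨s, ![u, v, w], hs, h1, ?_⟩
  convert h2 using 1
  rw [e]
  ext1 j
  fin_cases j <;> rfl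

end Flower

namespace Petersen

/-- The position of a nonzero element of the Klein four-group. -/
def colorIndex (s : V4) : ℕ := 2 * s.1.val + s.2.val - 1

/-- Encoded flows on the Petersen graph vanishing on a single edge. -/
def vanishing : List ℕ :=
  [1034540516, 1030415832, 696235420, 1050008292, 1045883608, 794213084, 900456292, 978841496,
    727170972, 917986193, 901487457, 636411505, 980903826, 964405090, 1030416242, 381647251,
    696235619, 762246771, 531199814, 795244422, 397114822, 530168649, 794213257, 727170761,
    450752077, 1045883789, 978841293, 735419678, 467250717, 513669913, 669408558, 401239597,
    385772333, 727170358, 397114937, 381647673, 795243641, 794212470, 978840679, 531199161,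
    530167990, 467250359, 762246361, 513669350, 450751719, 379580825, 695202201, 515731897,
    379581030, 695202406, 763277942, 400204663, 963371879, 1031447415, 442486373, 632278629,
    987090661, 442486170, 632278426, 904580570, 526027231, 633309599, 905611743, 694107542,
    380583318, 729233302, 694107753, 380583529, 398146409, 1029319549, 384708221, 402271101,
    627899993, 446496345, 534293341, 913599405, 446496166, 803493806, 660897529, 462994934,
    534292983, 363068774, 710147430, 933453166, 363069081, 710147737, 995339933, 368225245,
    777190361, 1062382557, 898324334, 914855838, 395048806, 961244013, 977775517, 726137753,
    760118905, 1044819677, 793181913, 388586990, 454729182, 522934126, 656764653, 722906845,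
    790080413, 909474745, 974585561, 1041759129, 479558585, 744127353, 945778285, 350662365,
    745191286, 883924382, 347601817, 679212902, 947906151, 592820150, 593853369, 846556909,
    328906614, 329939833, 314474105, 601331614, 334195565, 318729837, 158832542, 95923101,
    99024601, 175855470, 112946029, 117078905, 190815646, 128937581, 133070457]

lemma exists_vanishing (e₀ : Fin 15) (s : Bool → V4) (hs : ∀ b, s b ≠ 0) :
    ∃ f : Fin 15 → V4, (∀ e, f e = 0 ↔ e = e₀) ∧ (∀ x, ∑ i, f (half x i).1 = 0) ∧
      ∀ b i, (half (ends e₀ b) i).1 ≠ e₀ → f (half (ends e₀ b) i).1 = s b := by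
  have key : ∀ e₀ : Fin 15, ∀ s t : V4, s ≠ 0 ∧ t ≠ 0 →
      (fun f : Fin 15 → V4 => (∀ e, f e = 0 ↔ e = e₀) ∧ (∀ x, ∑ i, f (half x i).1 = 0) ∧
        ∀ b i, (half (ends e₀ b) i).1 ≠ e₀ → f (half (ends e₀ b) i).1 = if b then s else t)
      (fun e => Flower.digit (vanishing.getD (9 * e₀ + 3 * colorIndex s + colorIndex t) 0) e) := by
    unfold colorIndex
    decide +kernel
  refine ⟨_, (key e₀ (s true) (s false) ⟨hs _, hs _⟩).1, (key e₀ _ _ ⟨hs _, hs _⟩).2.1, ?_⟩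
  intro b i h
  refine ((key e₀ _ _ ⟨hs _, hs _⟩).2.2 b i h).trans ?_
  cases b <;> rfl

lemma exists_end_ne : ∀ e e₀, e ≠ e₀ → ∃ b, ∀ b', ends e b ≠ ends e₀ b' := by decide

end Petersen

namespace Super

open Petersen Flower

variable {k : Fin 15 → ℕ}

/-- For every dart of the superposition some flow vanishes only on its edge. -/
lemma exists_flow (hk : ∀ e, Even (k e)) (d₀ : Σ e, FlowerDart (k e)) :
    ∃ c, (presentation k).IsFlow c ∧ ∀ d, c d = 0 → d = d₀ ∨ d = (presentation k).rev d₀ := by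
  obtain ⟨e₀, d₀⟩ := d₀
  obtain ⟨c₀, hrev₀, hflux₀, hzero₀⟩ := Flower.exists_vanishing (hk e₀) d₀
  set L : Bool → Fin 3 → V4 := fun b s => c₀ (cut b, slot b s) with hL
  have hsplit : ∀ b, ∃ s B, s ≠ 0 ∧ Admissible s B ∧ Admissible s (fun j => L b j + B j) := by
    refine fun b => exists_admissible_split (L b) ?_ fun i j hi hj => ?_
    · rw [← hflux₀ (cut b)]
      exact Equiv.sum_comp ⟨slot b, slot b, slot_slot b, slot_slot b⟩ fun p => c₀ (cut b, p)
    · have key : ∀ d d', c₀ d = 0 → c₀ d' = 0 → d.1 = d'.1 → d = d' := by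
        intro d d' h h' hd
        rcases hzero₀ d h with rfl | rfl <;> rcases hzero₀ d' h' with rfl | rfl
        · rfl
        · exact absurd hd.symm (rev_vertex_ne _)
        · exact absurd hd (rev_vertex_ne _)
        · rfl
      have := congrArg Prod.snd (key _ _ hi hj rfl)
      simpa using congrArg (slot b) this
  choose s B hs hB hLB using hsplit
  obtain ⟨f, hf0, hfsum, hfs⟩ := Petersen.exists_vanishing e₀ s hs
  set D : Fin 10 → Fin 3 → Fin 3 → V4 := fun x i =>
    if (half x i).1 = e₀ then L (half x i).2
    else if (half x (i + 1)).1 = e₀ then B (half x (i + 1)).2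
    else if (half x (i + 2)).1 = e₀ then fun j => L (half x (i + 2)).2 j + B (half x (i + 2)).2 j
    else fun _ => f (half x i).1 with hD
  have hDsum : ∀ x j, ∑ i, D x i j = 0 := by
    intro x j
    by_cases h : ∃ i, (half x i).1 = e₀
    · obtain ⟨i, hi⟩ := h
      have hne : ∀ i', i' ≠ i → (half x i').1 ≠ e₀ := fun i' h h' =>
        h (half_injective x _ _ (h'.trans hi.symm))
      have h1 : D x i = L (half x i).2 := by simp [hD, hi]
      have h2 : D x (i + 2) = B (half x i).2 := by
        have e : i + 2 + 1 = i := by lia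
        simp [hD, e, hi, hne (i + 2) (by lia)]
      have h3 : D x (i + 1) = fun j => L (half x i).2 j + B (half x i).2 j := by
        have e : i + 1 + 2 = i := by lia
        have e' : i + 1 + 1 = i + 2 := by lia
        simp [hD, e, e', hi, hne (i + 1) (by lia), hne (i + 2) (by lia)]
      rw [← Equiv.sum_comp (Equiv.addLeft i), Fin.sum_univ_three]
      simp only [Equiv.coe_addLeft, add_zero, h1, h2, h3]
      rw [← add_assoc, CharTwo.add_self_eq_zero, zero_add, CharTwo.add_self_eq_zero]
    · push Not at h
      simp only [hD, h, if_false]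
      exact hfsum x
  have hloc : ∀ e, ∃ c : FlowerDart (k e) → V4, (∀ d, c (Flower.rev d) = c d) ∧
      (∀ w, (∀ b, w ≠ cut b) → flux c w = 0) ∧
      (∀ d, c d = 0 → (⟨e, d⟩ : Σ e, FlowerDart (k e)) = ⟨e₀, d₀⟩ ∨
        (⟨e, d⟩ : Σ e, FlowerDart (k e)) = ⟨e₀, Flower.rev d₀⟩) ∧
      ∀ x i j, (half x i).1 = e → c (cut (half x i).2, slot (half x i).2 j) = D x i j := by
    intro e
    by_cases he : e = e₀
    · subst he
      refine ⟨c₀, hrev₀, fun w _ => hflux₀ w, fun d hd => ?_, fun x i j hi => ?_⟩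
      · rcases hzero₀ d hd with rfl | rfl <;> simp
      · simp [hD, hi, hL]
    · obtain ⟨b, hb⟩ := exists_end_ne e e₀ he
      have hconst : ∀ x i, half x i = (e, b) → D x i = fun _ => f e := by
        intro x i hi
        have hx : ends e b = x := by rw [← ends_half x i, hi]
        have hne : ∀ i', (half x i').1 ≠ e₀ := fun i' h' => hb (half x i').2 <| by
          rw [hx, ← h', ends_half]
        simp [hD, hne, hi, he]
      have hadm : ∀ x i, half x i = (e, !b) → Admissible (f e) (D x i) := by
        intro x i hi
        have hfb : ∀ i', (half x i').1 = e₀ → s (half x i').2 = f e := by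
          intro i' hi'
          have hx : ends e₀ (half x i').2 = x := by rw [← hi', ends_half]
          have := hfs (half x i').2 i
          rw [hx, hi] at this
          exact (this he).symm
        simp only [hD]
        split_ifs with h h1 h2
        · exact absurd (by rw [← h, hi]) he
        · exact hfb _ h1 ▸ hB _
        · exact hfb _ h2 ▸ hLB _
        · rw [hi]
          refine ⟨fun _ => fun h => he ((hf0 e).1 h), ?_, fun _ _ => rfl⟩
          rw [Fin.sum_univ_three, CharTwo.add_self_eq_zero, zero_add]
      obtain ⟨i₀, hi₀⟩ := exists_half e (!b)
      obtain ⟨c, hrev, hflux, hne, hcB, hcs⟩ := exists_realizing (hk e)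
        (fun h => he ((hf0 e).1 h)) (hadm _ _ hi₀) (!b)
      refine ⟨c, hrev, hflux, fun d hd => absurd hd (hne d), fun x i j hi => ?_⟩
      rw [Bool.not_not] at hcs
      by_cases h : (half x i).2 = b
      · rw [hconst x i (Prod.ext hi h), h, hcs]
      · replace h : (half x i).2 = !b := Bool.eq_not_of_ne h
        have hx : ends e (!b) = x := by rw [← ends_half x i, hi, h]
        rw [h, hcB, hx]
        rw [hx] at hi₀
        rw [half_injective x i i₀ (by rw [hi, hi₀])]
  choose c hrev hflux hzero hcD using hloc
  refine ⟨fun d => c d.1 d.2, ⟨fun d => hrev _ _, ?_⟩, fun d hd => hzero _ _ hd⟩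
  rintro (⟨x, j⟩ | ⟨e, w, h, h'⟩)
  · rw [← hDsum x j]
    exact Finset.sum_congr rfl fun i _ => hcD _ x i j rfl
  · exact hflux e w (by rintro (_ | _) <;> assumption)

lemma critical {W : Type*} (hk : ∀ e, Even (k e)) (φ : SuperVertex k ≃ W) :
    Critical ((presentation k).relabel φ).graph :=
  CubicPresentation.critical_of_flow _ fun d₀ =>
    let ⟨c, hc, h⟩ := exists_flow hk d₀
    ⟨c, hc.relabel φ, h⟩

end Super

/-- Labels of the three leaves of a claw. -/
abbrev Labels : Type := Bool × Bool × Bool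

namespace Labels

/-- The label taken by most of the three leaves. -/
def maj (l : Labels) : Bool := l.1 && l.2.1 || l.1 && l.2.2 || l.2.1 && l.2.2

/-- The number of cut spokes of a claw whose centre is labelled by majority. -/
def spokes (l : Labels) : ℕ :=
  (l.1 != l.maj).toNat + (l.2.1 != l.maj).toNat + (l.2.2 != l.maj).toNat

/-- The number of cut rails between consecutive claws. -/
def rails (p l : Labels) : ℕ :=
  (p.2.1 != l.1).toNat + (p.1 != l.2.1).toNat + (p.2.2 != l.2.2).toNat

/-- At most one of three labels differs from the label `x`. -/
def tame (x p s n : Bool) : Bool :=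
  !((p != x) && (s != x)) && !((p != x) && (n != x)) && !((s != x) && (n != x))

/-- The matching condition at the leaves of a claw between two others. -/
def fits (p l n : Labels) : Bool :=
  tame l.1 p.2.1 l.maj n.2.1 && tame l.2.1 p.1 l.maj n.1 && tame l.2.2 p.2.2 l.maj n.2.2

/-- The matching condition along a chain of claws. -/
def chainFits : Labels → List Labels → Labels → Bool
  | _, [], _ => true
  | p, l :: L, q => fits p l (L.headD q) && chainFits l L q

/-- The number of cut edges along a chain of claws. -/
def chainCost : Labels → List Labels → Labels → ℕ
  | p, [], q => rails p q
  | p, l :: L, q => rails p l + spokes l + chainCost l L q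

/-- Conjunction over all labels. -/
def all (f : Labels → Bool) : Bool :=
  f (false, false, false) && f (false, false, true) && f (false, true, false) &&
    f (false, true, true) && f (true, false, false) && f (true, false, true) &&
    f (true, true, false) && f (true, true, true)

lemma of_all {f : Labels → Bool} (h : all f) (l : Labels) : f l := by
  simp only [all, Bool.and_eq_true] at h
  obtain ⟨_ | _, _ | _, _ | _⟩ := l <;> simp_all

/-- Disjunction over all labels. -/
def any (f : Labels → Bool) : Bool := !all fun l => !f l

lemma of_any {f : Labels → Bool} (h : any f) : ∃ l, f l := by
  by_contra! h'
  simp [any, all, h'] at h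

/-- Search through the chains with at most five cut edges, from the last claw to the first. -/
def search (q : Labels) (f : List Labels → Bool) : ℕ → List Labels → Bool
  | 0, A => f A
  | n + 1, A => all fun x => !(chainFits x A q && decide (spokes x + chainCost x A q ≤ 5)) ||
      search q f n (x :: A)

lemma of_search {q : Labels} {f : List Labels → Bool} {p : Labels} (L : List Labels) :
    ∀ n A, search q f n A → L.length = n → chainFits p (L ++ A) q →
      chainCost p (L ++ A) q ≤ 5 → f (L ++ A) := by
  have hsub : ∀ (M : List Labels) p x A, chainFits p (M ++ x :: A) q →
      chainFits x A q ∧ spokes x + chainCost x A q ≤ chainCost p (M ++ x :: A) q := by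
    intro M
    induction M with
    | nil =>
      intro p x A h
      simp only [List.nil_append, chainFits, Bool.and_eq_true, chainCost] at h ⊢
      exact ⟨h.2, by lia⟩
    | cons y M ih =>
      intro p x A h
      simp only [List.cons_append, chainFits, Bool.and_eq_true, chainCost] at h ⊢
      have := ih _ _ _ h.2
      exact ⟨this.1, by lia⟩
  induction L using List.reverseRecOn with
  | nil =>
    rintro n A h rfl - -
    exact h
  | append_singleton L x ih =>
    rintro n A h rfl hfit hcost
    rw [List.append_assoc, List.singleton_append] at hfit hcost ⊢
    obtain ⟨h1, h2⟩ := hsub L p x A hfit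
    rw [List.length_append] at h
    have := of_all h x
    have h3 : decide (spokes x + chainCost x A q ≤ 5) = true := by simpa using h2.trans hcost
    rw [h1, h3] at this
    exact ih _ _ (by simpa using this) rfl hfit hcost

/-- All labels in a list of claws are equal to `m`. -/
def isConst (m : Bool) (L : List Labels) : Bool := L.all fun l => l == (m, m, m)

/-- Six consecutive claws can be shortened to four. -/
def shortens (q : Labels) : List Labels → Bool
  | [a, b, c, d, e, f] => all fun p =>
      !(chainFits p [a, b, c, d, e, f] q && decide (chainCost p [a, b, c, d, e, f] q ≤ 5)) ||
        any fun x => any fun y => chainFits p [a, x, y, f] q &&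
          decide (chainCost p [a, x, y, f] q ≤ chainCost p [a, b, c, d, e, f] q) &&
          [true, false].all fun m => !isConst m [a, x, y, f] || isConst m [a, b, c, d, e, f]
  | _ => true

lemma shorten {p q a b c d e f : Labels} (h : chainFits p [a, b, c, d, e, f] q)
    (h' : chainCost p [a, b, c, d, e, f] q ≤ 5) :
    ∃ x y : Labels, chainFits p [a, x, y, f] q ∧
      chainCost p [a, x, y, f] q ≤ chainCost p [a, b, c, d, e, f] q ∧
      ∀ m : Bool, isConst m [a, x, y, f] → isConst m [a, b, c, d, e, f] := by
  have key : all fun q => search q (shortens q) 6 [] := by decide +kernel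
  have h0 := of_search (p := p) [a, b, c, d, e, f] _ _ (of_all key q) rfl
  rw [List.append_nil] at h0
  specialize h0 h h'
  rw [shortens] at h0
  have := of_all h0 p
  rw [h, decide_eq_true h', Bool.and_self, Bool.not_true, Bool.false_or] at this
  obtain ⟨x, hx⟩ := of_any this
  obtain ⟨y, hy⟩ := of_any hx
  simp only [Bool.and_eq_true, decide_eq_true_eq] at hy
  refine ⟨x, y, hy.1.1, hy.1.2, fun m hm => ?_⟩
  have := List.all_eq_true.1 hy.2 m (by cases m <;> simp)
  rwa [hm] at this

end Labels

/-- Labels around the two removed vertices of a flower: those of the remaining leaves of the first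
two claws, and those replacing the two vertices at the ends of their spokes and rails. -/
structure Frame where
  a₀ : Bool
  a₁ : Bool
  b₁ : Bool
  b₂ : Bool
  o : Labels
  u : Labels

namespace Frame

open Labels

variable (σ : Frame)

/-- Labels at the incoming rails of the first claw. -/
def in₀ : Labels := (σ.a₀, σ.a₁, σ.o.2.1)

/-- Labels at the spokes of the first claw. -/
def mid₀ : Labels := (σ.a₀, σ.a₁, σ.o.1)

/-- Labels at the outgoing rails of the first claw. -/
def out₀ : Labels := (σ.a₀, σ.a₁, σ.o.2.2)

/-- Labels at the incoming rails of the second claw. -/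
def in₁ : Labels := (σ.u.2.1, σ.b₁, σ.b₂)

/-- Labels at the spokes of the second claw. -/
def mid₁ : Labels := (σ.u.1, σ.b₁, σ.b₂)

/-- Labels at the outgoing rails of the second claw. -/
def out₁ : Labels := (σ.u.2.2, σ.b₁, σ.b₂)

/-- The matching condition at the remaining leaves of the first two claws. -/
def closes (h l : Labels) : Bool :=
  tame σ.a₀ l.2.1 σ.mid₀.maj σ.b₁ && tame σ.a₁ l.1 σ.mid₀.maj σ.u.2.1 &&
    tame σ.b₁ σ.a₀ σ.mid₁.maj h.1 && tame σ.b₂ σ.o.2.2 σ.mid₁.maj h.2.2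

/-- The number of cut edges of the flower with split vertices. -/
def cost (L : List Labels) : ℕ :=
  spokes σ.mid₀ + spokes σ.mid₁ + rails σ.out₀ σ.in₁ + chainCost σ.out₁ L σ.in₀

/-- The number of outer labels different from `m`. -/
def deviation (m : Bool) : ℕ :=
  (σ.o.1 != m).toNat + (σ.o.2.1 != m).toNat + (σ.o.2.2 != m).toNat +
    ((σ.u.1 != m).toNat + (σ.u.2.1 != m).toNat + (σ.u.2.2 != m).toNat)

/-- All labels except the outer ones are equal to `m`. -/
def isConst (m : Bool) (L : List Labels) : Bool :=
  σ.a₀ == m && σ.a₁ == m && σ.b₁ == m && σ.b₂ == m && Labels.isConst m L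

/-- Few outer labels differ from a common label of most vertices. -/
def isRigid (L : List Labels) (m : Bool) : Bool :=
  decide (σ.deviation m ≤ σ.cost L) && (σ.isConst m L || decide (2 ≤ σ.deviation m))

/-- Rigidity of all frames around a chain of claws. -/
def allRigid (q : Labels) (L : List Labels) : Bool :=
  Labels.all fun p => !(chainFits p L q && decide (chainCost p L q ≤ 5)) ||
    Labels.all fun x => [true, false].all fun t =>
      (fun σ : Frame => !(σ.closes (L.headD q) (L.getLastD q) && decide (σ.cost L ≤ 5)) ||
          [true, false].any (σ.isRigid L))
        ⟨q.1, q.2.1, p.2.1, p.2.2, (x.1, q.2.2, x.2.1), (x.2.2, t, p.1)⟩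

/-- A labelling of a flower with split vertices that cuts at most five edges, which form a
matching. -/
structure Valid (L : List Labels) : Prop where
  length : 3 ≤ L.length
  closes : σ.closes (L.headD σ.in₀) (L.getLastD σ.in₀)
  fits : chainFits σ.out₁ L σ.in₀
  cost : σ.cost L ≤ 5

lemma exists_isRigid_short {L : List Labels} (h : σ.Valid L) (hL : L.length ≤ 5) :
    ∃ m, σ.isRigid L m := by
  have key : [3, 4, 5].all fun n => Labels.all fun q => search q (allRigid q) n [] := by
    decide +kernel
  have hn : L.length ∈ [3, 4, 5] := by
    have := h.length
    simp only [List.mem_cons, List.not_mem_nil, or_false]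
    lia
  have h0 := of_search (p := σ.out₁) L _ _ (of_all (List.all_eq_true.1 key _ hn) σ.in₀) rfl
  rw [List.append_nil] at h0
  have hc : chainCost σ.out₁ L σ.in₀ ≤ 5 := le_trans (Nat.le_add_left _ _) h.cost
  specialize h0 h.fits hc
  rw [allRigid] at h0
  have h1 := of_all h0 σ.out₁
  rw [h.fits, decide_eq_true hc, Bool.and_self, Bool.not_true, Bool.false_or] at h1
  have h2 := List.all_eq_true.1 (of_all h1 (σ.o.1, σ.o.2.2, σ.u.1)) σ.u.2.1
    (by cases σ.u.2.1 <;> simp)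
  have h3 : (!(σ.closes (L.headD σ.in₀) (L.getLastD σ.in₀) && decide (σ.cost L ≤ 5)) ||
    [true, false].any (σ.isRigid L)) = true := h2
  rw [h.closes, decide_eq_true h.cost, Bool.and_self, Bool.not_true, Bool.false_or] at h3
  obtain ⟨m, -, hm⟩ := List.any_eq_true.1 h3
  exact ⟨m, hm⟩

lemma exists_isRigid {L : List Labels} (h : σ.Valid L) : ∃ m, σ.isRigid L m := by
  induction hn : L.length using Nat.strong_induction_on generalizing L with
  | _ n ih =>
    subst hn
    by_cases hL : L.length ≤ 5
    · exact σ.exists_isRigid_short h hL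
    match L with
    | [] | [_] | [_, _] | [_, _, _] | [_, _, _, _] | [_, _, _, _, _] => simp at hL
    | a :: b :: c :: d :: e :: f :: R =>
      have hR : ∃ N, chainCost f R σ.in₀ = rails f (R.headD σ.in₀) + N := by
        cases R with
        | nil => exact ⟨0, rfl⟩
        | cons x R => exact ⟨_, Nat.add_assoc _ _ _⟩
      obtain ⟨N, hN⟩ := hR
      have hfit := h.fits
      have hcost := h.cost
      simp only [chainFits, Bool.and_eq_true, List.headD_cons, cost, chainCost, hN] at hfit hcost
      obtain ⟨h1, h2, h3, h4, h5, h6, h7⟩ := hfit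
      obtain ⟨x, y, h8, h9, h10⟩ :=
        shorten (p := σ.out₁) (q := R.headD σ.in₀) (a := a) (b := b) (c := c)
          (d := d) (e := e) (f := f)
        (by simp only [chainFits, Bool.and_eq_true, List.headD_cons, List.headD_nil, and_true]
            exact ⟨h1, h2, h3, h4, h5, h6⟩)
        (by simp only [chainCost]; lia)
      simp only [chainFits, Bool.and_eq_true, List.headD_cons, chainCost, List.headD_nil] at h8 h9
      have hle : σ.cost (a :: x :: y :: f :: R) ≤ σ.cost (a :: b :: c :: d :: e :: f :: R) := by
        simp only [cost, chainCost, hN]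
        lia
      obtain ⟨m, hm⟩ := ih (a :: x :: y :: f :: R).length (by simp) (L := a :: x :: y :: f :: R)
        ⟨by simp, h.closes, by simp only [chainFits, Bool.and_eq_true, List.headD_cons]; tauto,
          hle.trans h.cost⟩ rfl
      refine ⟨m, ?_⟩
      have h11 := h10 m
      simp only [isRigid, isConst, Labels.isConst, Bool.and_eq_true, Bool.or_eq_true,
        decide_eq_true_eq, List.all_cons, List.all_nil] at hm h11 ⊢
      refine ⟨hm.1.trans hle, hm.2.imp_left fun hm => ⟨hm.1, ?_⟩⟩
      have := h11 ⟨hm.2.1, hm.2.2.1, hm.2.2.2.1, hm.2.2.2.2.1, trivial⟩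
      have := hm.2.2.2.2.2
      tauto

end Frame

namespace Labels

lemma chainCost_map (X : ℕ → Labels) (n s : ℕ) :
    chainCost (X s) ((List.range' (s + 1) n).map X) (X (s + n + 1)) =
      ∑ i ∈ Finset.range n, (rails (X (s + i)) (X (s + i + 1)) + spokes (X (s + i + 1))) +
        rails (X (s + n)) (X (s + n + 1)) := by
  induction n generalizing s with
  | zero => simp [chainCost]
  | succ n ih =>
    rw [List.range'_succ, List.map_cons, chainCost, Finset.sum_range_succ']
    have := ih (s + 1)
    simp only [Nat.add_right_comm s 1, ← Nat.add_assoc, Nat.add_zero] at this ⊢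
    rw [this]
    lia

lemma chainFits_map (X : ℕ → Labels) (n s : ℕ)
    (h : ∀ i, s ≤ i → i < s + n → fits (X i) (X (i + 1)) (X (i + 2))) :
    chainFits (X s) ((List.range' (s + 1) n).map X) (X (s + n + 1)) := by
  induction n generalizing s with
  | zero => rfl
  | succ n ih =>
    rw [List.range'_succ, List.map_cons, chainFits, Bool.and_eq_true]
    refine ⟨?_, ?_⟩
    · convert h s le_rfl (by lia) using 1
      cases n <;> rfl
    · convert ih (s + 1) (fun i hi hi' => h i (by lia) (by lia)) using 3
      lia

end Labels

namespace Flower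

open Labels

variable {k : ℕ} (c : FlowerDart k → Bool)

/-- The labels of the darts in slot `p` at the leaves of a claw. -/
def claw (p : Fin 3) (i : Fin (k + 5)) : Labels :=
  (c ((i, some 0), p), c ((i, some 1), p), c ((i, some 2), p))

/-- The frame of a labelling of darts. -/
def frame : Frame where
  a₀ := c ((0, some 0), 0)
  a₁ := c ((0, some 1), 0)
  b₁ := c ((1, some 1), 0)
  b₂ := c ((1, some 2), 0)
  o := (c (cut true, 0), c (cut true, 1), c (cut true, 2))
  u := (c (cut false, 0), c (cut false, 1), c (cut false, 2))

/-- The labels of the claws from the second one to the first of the next round. -/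
def seq (i : ℕ) : Labels := if i = k + 5 then claw c 1 0 else claw c 2 (Fin.ofNat (k + 5) i)

/-- The labels of the claws outside the frame. -/
def chain : List Labels := (List.range' 2 (k + 3)).map (seq c)

/-- A labelling of darts that agrees on the darts leaving a vertex that is not removed, and for
which the cut edges form a matching. -/
structure IsLabelling : Prop where
  eq : ∀ w, (∀ b, w ≠ cut b) → ∀ p q, c (w, p) = c (w, q)
  matching : ∀ w, (∀ b, w ≠ cut b) → ∀ p q, c (rev (w, p)) ≠ c (w, p) →
    c (rev (w, q)) ≠ c (w, q) → p = q

variable {c}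

lemma IsLabelling.center (h : IsLabelling c) (i : Fin (k + 5)) (p : Fin 3) :
    c ((i, none), p) = (claw c 0 i).maj := by
  have key : ∀ x y z t : Bool, (x ≠ t → y ≠ t → False) ∧ (x ≠ t → z ≠ t → False) ∧
      (y ≠ t → z ≠ t → False) → t = maj (x, y, z) := by decide
  have hw : ∀ b, (i, none) ≠ cut (k := k) b := by rintro (_ | _) <;> simp [cut]
  have h' : ∀ j j' : Fin 3, j ≠ j' → c ((i, some j), 0) ≠ c ((i, none), p) →
      c ((i, some j'), 0) ≠ c ((i, none), p) → False := fun j j' hj h1 h2 =>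
    hj (h.matching (i, none) hw j j' (by rwa [h.eq _ hw j p]) (by rwa [h.eq _ hw j' p]))
  exact key _ _ _ _ ⟨h' _ _ (by decide), h' _ _ (by decide), h' _ _ (by decide)⟩

lemma IsLabelling.tame (h : IsLabelling c) {i : Fin (k + 5)} {j : Fin 3}
    (hw : ∀ b, (i, some j) ≠ cut (k := k) b) (p : Fin 3) :
    tame (c ((i, some j), p)) (c ((prev i, some (twist j)), 2)) (claw c 0 i).maj
      (c ((next i, some (twist j)), 1)) := by
  have key : ∀ t x y z : Bool, (x ≠ t → y ≠ t → False) ∧ (x ≠ t → z ≠ t → False) ∧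
      (y ≠ t → z ≠ t → False) → Labels.tame t x y z := by decide
  rw [← h.center i j]
  have h' : ∀ q q' : Fin 3, q ≠ q' → c (rev ((i, some j), q)) ≠ c ((i, some j), p) →
      c (rev ((i, some j), q')) ≠ c ((i, some j), p) → False := fun q q' hq h1 h2 =>
    hq (h.matching _ hw q q' (by rwa [h.eq _ hw q p]) (by rwa [h.eq _ hw q' p]))
  exact key _ _ _ _ ⟨h' 1 0 (by decide), h' 1 2 (by decide), h' 0 2 (by decide)⟩

lemma IsLabelling.claw_eq (h : IsLabelling c) {i : Fin (k + 5)} (hi : 2 ≤ i.1) (p q : Fin 3) :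
    claw c p i = claw c q i := by
  have h' : ∀ j b, (i, some j) ≠ cut (k := k) b := by
    intro j b h
    have : i.1 = (cut (k := k) b).1.1 := congrArg (fun w => w.1.1) h
    cases b <;> simp [cut] at this <;> lia
  exact Prod.ext (h.eq _ (h' 0) p q) (Prod.ext (h.eq _ (h' 1) p q) (h.eq _ (h' 2) p q))

/-- The number of cut edges of a flower with split vertices. -/
lemma IsLabelling.card_eq (h : IsLabelling c) :
    (Finset.univ.filter fun d => c (rev d) ≠ c d).card =
      2 * ∑ i, (spokes (claw c 0 i) + rails (claw c 2 (prev i)) (claw c 1 i)) := by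
  have e1 : ∀ i, ∑ j, (c ((i, some j), 0) != c ((i, none), j)).toNat = spokes (claw c 0 i) := by
    intro i
    simp only [h.center i]
    rw [Fin.sum_univ_three]
    rfl
  have e2 : ∀ i, ∑ j, (c ((prev i, some (twist j)), 2) != c ((i, some j), 1)).toNat =
      rails (claw c 2 (prev i)) (claw c 1 i) := by
    intro i
    rw [Fin.sum_univ_three]
    rfl
  have e3 : ∑ i, ∑ j, (c ((next i, some (twist j)), 1) != c ((i, some j), 2)).toNat =
      ∑ i, ∑ j, (c ((prev i, some (twist j)), 2) != c ((i, some j), 1)).toNat := by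
    rw [← Equiv.sum_comp nextEquiv fun i => ∑ j, (c ((prev i, some (twist j)), 2) !=
      c ((i, some j), 1)).toNat]
    refine Finset.sum_congr rfl fun i _ => ?_
    rw [← Equiv.sum_comp twistEquiv]
    refine Finset.sum_congr rfl fun j _ => ?_
    simp [nextEquiv, twistEquiv, bne_comm]
  have e4 : ∀ d : FlowerDart k, (if c (rev d) ≠ c d then 1 else 0) = (c (rev d) != c d).toNat := by
    intro d
    cases c (rev d) <;> cases c d <;> rfl
  rw [Finset.card_filter]
  simp only [e4, Fintype.sum_prod_type, Fintype.sum_option]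
  have e5 : ∀ i : Fin (k + 5), ∑ j, ∑ p, (c (rev ((i, some j), p)) != c ((i, some j), p)).toNat =
      spokes (claw c 0 i) + rails (claw c 2 (prev i)) (claw c 1 i) +
        ∑ j, (c ((next i, some (twist j)), 1) != c ((i, some j), 2)).toNat := by
    intro i
    rw [← e1, ← e2, ← Finset.sum_add_distrib, ← Finset.sum_add_distrib]
    refine Finset.sum_congr rfl fun j _ => ?_
    rw [Fin.sum_univ_three, bne_comm]
    rfl
  have e6 : ∀ i : Fin (k + 5), ∑ p, (c (rev ((i, none), p)) != c ((i, none), p)).toNat =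
      spokes (claw c 0 i) := e1
  simp only [e5, e6, Finset.sum_add_distrib, e3, e2]
  ring

/-- A labelling of a flower with at most five cut edges has a common label. -/
lemma IsLabelling.exists_rigid (h : IsLabelling c)
    (hc : (Finset.univ.filter fun d => c (rev d) ≠ c d).card ≤ 11) :
    ∃ m, 2 * (∑ b, ∑ p, (c (cut b, p) != m).toNat) ≤
        (Finset.univ.filter fun d => c (rev d) ≠ c d).card ∧
      ((∀ w, (∀ b, w ≠ cut b) → ∀ p, c (w, p) = m) ∨
        2 ≤ ∑ b, ∑ p, (c (cut b, p) != m).toNat) := by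
  have hne : ∀ j, j ≠ 2 → ∀ b, ((0 : Fin (k + 5)), some j) ≠ cut b := by
    rintro j hj (_ | _) <;> simp [cut, hj]
  have hne' : ∀ j, j ≠ 0 → ∀ b, ((1 : Fin (k + 5)), some j) ≠ cut b := by
    rintro j hj (_ | _) <;> simp [cut, hj]
  have h0 : ∀ p q, c ((0, some 0), p) = c ((0, some 0), q) ∧
      c ((0, some 1), p) = c ((0, some 1), q) := fun p q =>
    ⟨h.eq _ (hne 0 (by decide)) p q, h.eq _ (hne 1 (by decide)) p q⟩
  have h1 : ∀ p q, c ((1, some 1), p) = c ((1, some 1), q) ∧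
      c ((1, some 2), p) = c ((1, some 2), q) := fun p q =>
    ⟨h.eq _ (hne' 1 (by decide)) p q, h.eq _ (hne' 2 (by decide)) p q⟩
  have hin : (frame c).in₀ = claw c 1 0 := Prod.ext (h0 0 1).1 (Prod.ext (h0 0 1).2 rfl)
  have hout : (frame c).out₀ = claw c 2 0 := Prod.ext (h0 0 2).1 (Prod.ext (h0 0 2).2 rfl)
  have hin' : (frame c).in₁ = claw c 1 1 := Prod.ext rfl (Prod.ext (h1 0 1).1 (h1 0 1).2)
  have hout' : (frame c).out₁ = claw c 2 1 := Prod.ext rfl (Prod.ext (h1 0 2).1 (h1 0 2).2)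
  have hseq : ∀ i : Fin (k + 5), seq c i = claw c 2 i := fun i => by
    simp [seq, i.2.ne]
  have hpred : ∀ {i : ℕ} {j : Fin (k + 5)}, i + 1 = j → seq c i = claw c 2 (prev j) :=
    fun {i j} hij => by
      rw [← hseq, show ((prev j : Fin (k + 5)) : ℕ) = i by simp only [prev]; split_ifs <;> lia]
  have hsucc : ∀ {i : ℕ} {j : Fin (k + 5)}, 1 ≤ j.1 → j.1 + 1 = i →
      seq c i = claw c 1 (next j) := by
    rintro i j hj rfl
    by_cases hk : j.1 = k + 4
    · rw [show next j = 0 by simp [next, hk]]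
      simp [seq, hk]
    · have : (next j).1 = j.1 + 1 := by simp [next, hk]
      rw [← this, hseq, h.claw_eq (by lia)]
  have hlast : seq c (k + 4) = claw c 2 (prev 0) := by
    rw [← hseq]
    simp [prev]
  have hend : seq c (1 + (k + 3) + 1) = (frame c).in₀ := by
    rw [hin, seq, if_pos (by lia)]
  have hstart : (frame c).out₁ = seq c 1 := hout'.trans (hseq 1).symm
  have hnext : next (0 : Fin (k + 5)) = 1 := by simp [next]
  have hprev : prev (1 : Fin (k + 5)) = 0 := by simp [prev]
  have hcost : (Finset.univ.filter fun d => c (rev d) ≠ c d).card =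
      2 * (frame c).cost (chain c) := by
    have h2 : ∀ i : Fin (k + 3), spokes (claw c 0 i.succ.succ) +
        rails (claw c 2 (prev i.succ.succ)) (claw c 1 i.succ.succ) =
          rails (seq c (1 + i)) (seq c (1 + i + 1)) + spokes (seq c (1 + i + 1)) := by
      intro i
      have hi : i.succ.succ.1 = 1 + i + 1 := by simp; lia
      rw [hpred hi.symm, ← hi, hseq, h.claw_eq (by lia) 0 2, h.claw_eq (by lia) 1 2, Nat.add_comm]
    rw [h.card_eq, Fin.sum_univ_succ, Fin.sum_univ_succ, Finset.sum_congr rfl fun i _ => h2 i,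
      Frame.cost, hstart, ← hend, chain, chainCost_map, Finset.sum_range, hend,
      show 1 + (k + 3) = k + 4 by lia, hlast, hin, hin', hout, Fin.succ_zero_eq_one, hprev,
      show (frame c).mid₀ = claw c 0 0 from rfl, show (frame c).mid₁ = claw c 0 1 from rfl]
    ring
  have hhead : (chain c).headD (frame c).in₀ = claw c 1 (next 1) := by
    rw [← hsucc (i := 2) (by simp) (by simp)]
    rfl
  have hgetLast : (chain c).getLastD (frame c).in₀ = claw c 2 (prev 0) := by
    rw [← hlast, chain, List.range'_concat, List.map_append, List.map_singleton,
      List.getLastD_concat]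
    congr 1
    lia
  have hcloses : (frame c).closes ((chain c).headD (frame c).in₀)
      ((chain c).getLastD (frame c).in₀) := by
    rw [hhead, hgetLast]
    have t1 := h.tame (hne 0 (by decide)) 0
    have t2 := h.tame (hne 1 (by decide)) 0
    have t3 := h.tame (hne' 1 (by decide)) 0
    have t4 := h.tame (hne' 2 (by decide)) 0
    rw [hnext, show twist 0 = 1 from rfl, (h1 1 0).1] at t1
    rw [hnext] at t2
    rw [hprev, show twist 1 = 0 from rfl, (h0 2 0).1] at t3
    rw [hprev] at t4
    simp only [Frame.closes, Bool.and_eq_true]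
    exact ⟨⟨⟨t1, t2⟩, t3⟩, t4⟩
  have hfits : chainFits (frame c).out₁ (chain c) (frame c).in₀ := by
    rw [hstart, ← hend]
    refine chainFits_map _ _ _ fun i hi hi' => ?_
    obtain ⟨j, hj⟩ : ∃ j : Fin (k + 5), i + 1 = j := ⟨⟨i + 1, by lia⟩, rfl⟩
    rw [hpred hj, hsucc (i := i + 2) (j := j) (by lia) (by lia), hj, hseq]
    have hne : ∀ l b, (j, some l) ≠ cut (k := k) b := by
      intro l b h
      have : j.1 = (cut (k := k) b).1.1 := congrArg (fun w => w.1.1) h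
      cases b <;> simp [cut] at this <;> lia
    simp only [fits, Bool.and_eq_true, h.claw_eq (show 2 ≤ j.1 by lia) 2 0]
    exact ⟨⟨h.tame (hne 0) 0, h.tame (hne 1) 0⟩, h.tame (hne 2) 0⟩
  obtain ⟨m, hm⟩ := (frame c).exists_isRigid (L := chain c)
    ⟨by simp [chain], hcloses, hfits, by lia⟩
  have hdev : ∑ b, ∑ p, (c (cut b, p) != m).toNat = (frame c).deviation m := by
    rw [Fintype.sum_bool, Fin.sum_univ_three, Fin.sum_univ_three]
    rfl
  refine ⟨m, ?_⟩
  rw [hdev, hcost]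
  simp only [Frame.isRigid, Bool.and_eq_true, Bool.or_eq_true, decide_eq_true_eq] at hm
  refine ⟨by lia, hm.2.imp_left fun hm => ?_⟩
  simp only [Frame.isConst, Labels.isConst, Bool.and_eq_true, beq_iff_eq, List.all_eq_true] at hm
  obtain ⟨⟨⟨⟨ha₀, ha₁⟩, hb₁⟩, hb₂⟩, hL⟩ := hm
  have hclaw : ∀ i : Fin (k + 5), 2 ≤ i.1 → claw c 0 i = (m, m, m) := fun i hi => by
    rw [h.claw_eq hi 0 2, ← hseq]
    refine hL _ (List.mem_map.2 ⟨i, ?_, rfl⟩)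
    rw [List.mem_range'_1]
    lia
  have h01 : ∀ i : Fin (k + 5), i = 0 ∨ i = 1 ∨ 2 ≤ i.1 := fun i => by
    simp only [Fin.ext_iff, Fin.val_zero, Fin.val_one]
    lia
  rintro ⟨i, _ | l⟩ hw p
  · rw [h.center i p]
    rcases h01 i with rfl | rfl | hi
    · rw [show claw c 0 0 = (m, m, _) from Prod.ext ha₀ (Prod.ext ha₁ rfl)]
      cases m <;> simp [maj]
    · rw [show claw c 0 1 = (_, m, m) from Prod.ext rfl (Prod.ext hb₁ hb₂)]
      cases m <;> simp [maj]
    · rw [hclaw i hi]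
      cases m <;> rfl
  · rw [h.eq _ hw p 0]
    rcases h01 i with rfl | rfl | hi
    · fin_cases l
      · exact ha₀
      · exact ha₁
      · exact absurd rfl (hw true)
    · fin_cases l
      · exact absurd rfl (hw false)
      · exact hb₁
      · exact hb₂
    · have := hclaw i hi
      simp only [claw, Prod.mk.injEq] at this
      fin_cases l
      · exact this.1
      · exact this.2.1
      · exact this.2.2

end Flower

namespace Petersen

/-- A labelling of the edges that is constant at all vertices but one is constant. -/
lemma eq_of_mono (m : Fin 15 → Bool) (x₀ : Fin 10)
    (h : ∀ x, x ≠ x₀ → ∀ i j, m (half x i).1 = m (half x j).1) (e e' : Fin 15) : m e = m e' := by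
  have h1 : ∀ x, x ≠ x₀ → m (half x 0).1 = m (half x 1).1 ∧ m (half x 0).1 = m (half x 2).1 :=
    fun x hx => ⟨h x hx 0 1, h x hx 0 2⟩
  suffices ∀ e, m e = m 0 from (this e).trans (this e').symm
  simp only [Fin.forall_fin_succ, half] at h1 ⊢
  clear h
  fin_cases x₀ <;> simp at h1 ⊢ <;> grind

/-- Labels of the edges and of the triples at the vertices with few disagreements are constant. -/
lemma const_of_few {m : Fin 15 → Bool} {T : Fin 10 × Fin 3 → Bool}
    (h : ∑ e, ∑ b, ∑ s, (T (ends e b, s) != m e).toNat ≤ 5) :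
    ∃ μ, (∀ e, m e = μ) ∧ ∑ y, (T y != μ).toNat ≤ 1 := by
  have h1 : ∑ e, ∑ b, ∑ s, (T (ends e b, s) != m e).toNat =
      ∑ x, ∑ i, ∑ s, (T (x, s) != m (half x i).1).toNat := by
    rw [← Fintype.sum_prod_type', ← Fintype.sum_prod_type' (f := fun x i => ∑ s, _),
      ← (Equiv.ofBijective _ half_bijective).sum_comp]
    simp [ends_half]
  rw [h1] at h
  have h2 : ∀ x, (∃ i j, m (half x i).1 ≠ m (half x j).1) →
      3 ≤ ∑ i, ∑ s, (T (x, s) != m (half x i).1).toNat := by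
    rintro x ⟨i, j, hij⟩
    rw [Finset.sum_comm]
    refine le_trans (by simp) (Finset.sum_le_sum (f := fun _ : Fin 3 => 1) fun s _ => ?_)
    by_contra! hs
    have : ∀ i, (T (x, s) != m (half x i).1).toNat = 0 := fun i =>
      (Finset.sum_eq_zero_iff.1 (Nat.lt_one_iff.1 hs)) i (Finset.mem_univ i)
    have h3 : ∀ i, T (x, s) = m (half x i).1 := fun i => by simpa using this i
    exact hij ((h3 i).symm.trans (h3 j))
  have h3 : ∃ x₀, ∀ x, x ≠ x₀ → ∀ i j, m (half x i).1 = m (half x j).1 := by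
    by_contra! h3
    obtain ⟨x, -, hx⟩ := h3 0
    obtain ⟨x', hx', hx''⟩ := h3 x
    have := Finset.add_le_sum (s := Finset.univ)
      (f := fun x => ∑ i, ∑ s, (T (x, s) != m (half x i).1).toNat)
      (fun _ _ => Nat.zero_le _) (Finset.mem_univ x) (Finset.mem_univ x') hx'.symm
    have := h2 x hx
    have := h2 x' hx''
    lia
  obtain ⟨x₀, h3⟩ := h3
  have h4 := fun e => eq_of_mono m x₀ h3 e 0
  refine ⟨m 0, h4, ?_⟩
  simp only [h4, Finset.sum_const, Finset.card_univ, Fintype.card_fin, smul_eq_mul,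
    ← Finset.mul_sum] at h
  rw [Fintype.sum_prod_type]
  lia

end Petersen

namespace Super

open Petersen Flower

variable {k : Fin 15 → ℕ}

/-- Small matching cuts of the superposition are trivial. -/
lemma eq_of_isMatchingCut {ℓ : SuperVertex k → Bool} (hℓ : (presentation k).IsMatchingCut ℓ)
    (hcard : ((presentation k).mixed ℓ).card ≤ 11) (a b : SuperVertex k) : ℓ a = ℓ b := by
  set c : ∀ e, FlowerDart (k e) → Bool := fun e d => ℓ (vtx ⟨e, d⟩) with hc
  have hlab : ∀ e, IsLabelling (c e) := by
    refine fun e => ⟨fun w hw p q => ?_, fun w hw p q hp hq => ?_⟩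
    · simp only [hc, vtx_inner hw]
    · simp only [hc, vtx_inner hw] at hp hq
      exact hℓ (.inr ⟨e, w, hw true, hw false⟩) p q hp hq
  have hsum : ((presentation k).mixed ℓ).card =
      ∑ e, (Finset.univ.filter fun d => c e (Flower.rev d) ≠ c e d).card := by
    simp only [Finset.card_filter]
    rw [← Fintype.sum_sigma', ← Finset.card_filter]
    rfl
  have hle : ∀ e, (Finset.univ.filter fun d => c e (Flower.rev d) ≠ c e d).card ≤ 11 := fun e =>
    (Finset.single_le_sum (f := fun e => (Finset.univ.filter fun d =>
      c e (Flower.rev d) ≠ c e d).card) (fun _ _ => Nat.zero_le _) (Finset.mem_univ e)).trans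
        (hsum ▸ hcard)
  choose m hm hm' using fun e => (hlab e).exists_rigid (hle e)
  have hdev : ∀ e b (μ : Bool), ∑ p, (c e (cut b, p) != μ).toNat =
      ∑ s, (ℓ (.inl (ends e b, s)) != μ).toNat := by
    intro e b μ
    rw [← Equiv.sum_comp ⟨slot b, slot b, slot_slot b, slot_slot b⟩]
    simp [hc, vtx_cut]
  simp only [hdev] at hm hm'
  obtain ⟨μ, hμ, hT⟩ := const_of_few (m := m) (T := fun y => ℓ (.inl y)) <| by
    have := Finset.sum_le_sum fun e (_ : e ∈ Finset.univ) => hm e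
    rw [← hsum, ← Finset.mul_sum] at this
    lia
  simp only [hμ] at hm'
  have hinner : ∀ e w, ℓ (.inr ⟨e, w⟩) = μ := by
    intro e w
    have h1 : ∀ b, w.1 ≠ cut b := by
      rintro (_ | _)
      exacts [w.2.2, w.2.1]
    have h2 := (hm' e).resolve_right <| by
      rw [← Fintype.sum_prod_type' (f := fun b s => (ℓ (.inl (ends e b, s)) != μ).toNat)]
      have hinj : Function.Injective fun y : Bool × Fin 3 => (ends e y.1, y.2) := by
        rintro ⟨b, s⟩ ⟨b', s'⟩ h
        have := ends_ne e
        have := (ends_ne e).symm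
        cases b <;> cases b' <;> simp_all
      have h3 := Finset.sum_le_univ_sum_of_nonneg (s := Finset.univ.map ⟨_, hinj⟩)
        (f := fun y => (ℓ (.inl y) != μ).toNat) fun _ => Nat.zero_le _
      rw [Finset.sum_map] at h3
      exact not_le.2 (Nat.lt_succ_of_le (h3.trans hT))
    rw [← h2 w.1 h1 0]
    simp only [hc, vtx_inner h1]
  have hall : ∀ v, ℓ v = μ := by
    rintro (⟨x, s⟩ | ⟨e, w⟩)
    · by_contra hne
      have h1 : ∀ p, ℓ ((presentation k).nbr (.inl (x, s)) p) ≠ ℓ (.inl (x, s)) := fun p => by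
        obtain ⟨w, h, h', h1, -⟩ := nbr_triple (k := k) x s p
        rw [h1, hinner]
        exact Ne.symm hne
      exact absurd (hℓ _ 0 1 (h1 0) (h1 1)) (by decide)
    · exact hinner e w
  rw [hall, hall]

end Super

namespace CubicPresentation

variable {V D W : Type*} (P : CubicPresentation V D) (φ : V ≃ W)

lemma mixed_relabel [Fintype D] (ℓ : W → Bool) : (P.relabel φ).mixed ℓ = P.mixed (ℓ ∘ φ) := rfl

variable {P φ} in
lemma IsMatchingCut.of_relabel {ℓ : W → Bool} (h : (P.relabel φ).IsMatchingCut ℓ) :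
    P.IsMatchingCut (ℓ ∘ φ) := by
  intro v p q hp hq
  apply h (φ v) p q <;> simpa [nbr, relabel] using ‹_›

end CubicPresentation

namespace Super

variable {k : Fin 15 → ℕ} {W : Type*}

lemma connected (φ : SuperVertex k ≃ W) : ((presentation k).relabel φ).graph.Connected := by
  have : Nonempty W := ⟨φ (.inl 0)⟩
  refine CubicPresentation.connected_of_cut _ fun ℓ hℓ a b => ?_
  rw [CubicPresentation.mixed_relabel] at hℓ
  have hcut : (presentation k).IsMatchingCut (ℓ ∘ φ) := by
    intro v p _ hp
    have : (presentation k).dart v p ∈ (presentation k).mixed (ℓ ∘ φ) := by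
      simpa [CubicPresentation.mem_mixed, CubicPresentation.nbr, (presentation k).vtx_dart] using hp
    simp [hℓ] at this
  simpa using eq_of_isMatchingCut hcut (by simp [hℓ]) (φ.symm a) (φ.symm b)

lemma cyclicallyConnected (φ : SuperVertex k ≃ W) :
    CyclicallyConnected ((presentation k).relabel φ).graph 6 := by
  have : Finite W := .of_equiv _ φ
  refine CubicPresentation.cyclicallyConnected_of_cut _ _ fun ℓ hℓ hcard a b => ?_
  rw [CubicPresentation.mixed_relabel] at hcard
  simpa using eq_of_isMatchingCut hℓ.of_relabel (by lia) (φ.symm a) (φ.symm b)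

end Super

/-- For every integer `n ≡ 4 (mod 8)` with `n ≥ 324` there exists a
cyclically 6-connected strictly critical snark of order `n`. -/
theorem exists_cyclically6Connected_strictlyCritical_snark_mod8_eq_4
    (n : ℕ) (hn : n % 8 = 4) (hn324 : 324 ≤ n) :
    ∃ G : SimpleGraph (Fin n),
      IsSnark G ∧ CyclicallyConnected G 6 ∧ StrictlyCritical G := by
  set k : Fin 15 → ℕ := Pi.single 0 ((n - 300) / 4) with hk_def
  have hk : ∀ e, Even (k e) := by
    intro e
    by_cases he : e = 0
    · subst he
      simp only [hk_def, Pi.single_eq_same, Nat.even_iff]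
      lia
    · simp [hk_def, he]
  have hcard : Fintype.card (SuperVertex k) = n := by
    rw [Super.card_superVertex, Finset.sum_add_distrib, ← Finset.mul_sum]
    simp only [hk_def, Finset.sum_pi_single', Finset.mem_univ, if_true, Finset.sum_const,
      Finset.card_univ, Fintype.card_fin, smul_eq_mul]
    lia
  let φ := Fintype.equivFinOfCardEq hcard
  exact ⟨_, ⟨Super.connected φ, CubicPresentation.isCubic _,
    Super.not_threeEdgeColorable hk φ⟩, Super.cyclicallyConnected φ, Super.critical hk φ,
    Super.not_bicritical hk φ⟩
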